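/- arXiv:1407.2300 — 3 statements merged into one kernel-verified Lean document; each statement's English description precedes it below -/
import Mathlib

section
/- For every field K there exists a finite-dimensional associative unital K-algebra Λ with l.Findim Λ = 2 together with a simple left Λ-module S that admits no left P^∞(Λ-mod)-approximation; in particular, P^∞(Λ-mod) is not covariantly finite in Λ-mod. (Consequently, the implication 'l.findim Λ ≤ 1 implies covariant finiteness of P^∞(Λ-mod)' does not extend to algebras of finitistic dimension 2.) -/
universe u

/-- `HasProjDimLE Λ n M` means the left `Λ`-module `M` has projective dimension `≤ n`:
for `n = 0` it is projective, and for `n+1` there is a surjection from a projective module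
whose kernel has projective dimension `≤ n`. -/
def HasProjDimLE (Λ : Type u) [Ring Λ] : ℕ → ModuleCat.{u} Λ → Prop
  | 0, M => Module.Projective Λ M
  | n + 1, M => ∃ (P : ModuleCat.{u} Λ) (g : P →ₗ[Λ] M),
      Module.Projective Λ P ∧ Function.Surjective g ∧
        HasProjDimLE Λ n (ModuleCat.of Λ (LinearMap.ker g))

/-- A module has finite projective dimension. -/
def HasFinProjDim (Λ : Type u) [Ring Λ] (M : ModuleCat.{u} Λ) : Prop :=
  ∃ n, HasProjDimLE Λ n M

/-- `f : A → M` is a right `P^∞(Λ-mod)`-approximation of `M`. -/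
def IsRightApprox (Λ : Type u) [Ring Λ] (M A : ModuleCat.{u} Λ) (f : A →ₗ[Λ] M) : Prop :=
  Module.Finite Λ A ∧ HasFinProjDim Λ A ∧
    ∀ (B : ModuleCat.{u} Λ), Module.Finite Λ B → HasFinProjDim Λ B →
      ∀ g : B →ₗ[Λ] M, ∃ h : B →ₗ[Λ] A, f ∘ₗ h = g

/-- `f : M → A` is a left `P^∞(Λ-mod)`-approximation of `M`. -/
def IsLeftApprox (Λ : Type u) [Ring Λ] (M A : ModuleCat.{u} Λ) (f : M →ₗ[Λ] A) : Prop :=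
  Module.Finite Λ A ∧ HasFinProjDim Λ A ∧
    ∀ (B : ModuleCat.{u} Λ), Module.Finite Λ B → HasFinProjDim Λ B →
      ∀ g : M →ₗ[Λ] B, ∃ h : A →ₗ[Λ] B, h ∘ₗ f = g

/-- `P^∞(Λ-mod)` is contravariantly finite in `Λ-mod`. -/
def ContravariantlyFinite (Λ : Type u) [Ring Λ] : Prop :=
  ∀ M : ModuleCat.{u} Λ, Module.Finite Λ M →
    ∃ (A : ModuleCat.{u} Λ) (f : A →ₗ[Λ] M), IsRightApprox Λ M A f

/-- `P^∞(Λ-mod)` is covariantly finite in `Λ-mod`. -/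
def CovariantlyFinite (Λ : Type u) [Ring Λ] : Prop :=
  ∀ M : ModuleCat.{u} Λ, Module.Finite Λ M →
    ∃ (A : ModuleCat.{u} Λ) (f : M →ₗ[Λ] A), IsLeftApprox Λ M A f

/-- The projective dimension of a module, as an element of `ℕ∞` (`⊤` if infinite). -/
noncomputable def projDim (Λ : Type u) [Ring Λ] (M : ModuleCat.{u} Λ) : ℕ∞ :=
  sInf {d : ℕ∞ | ∃ n : ℕ, d = n ∧ HasProjDimLE Λ n M}

/-- The little finitistic dimension `l.findim Λ`. -/
noncomputable def finDimLittle (Λ : Type u) [Ring Λ] : ℕ∞ :=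
  ⨆ (M : ModuleCat.{u} Λ) (_ : Module.Finite Λ M ∧ HasFinProjDim Λ M), projDim Λ M

/-- The big finitistic dimension `l.Findim Λ`. -/
noncomputable def finDimBig (Λ : Type u) [Ring Λ] : ℕ∞ :=
  ⨆ (M : ModuleCat.{u} Λ) (_ : HasFinProjDim Λ M), projDim Λ M

/-- `M` is a direct limit of a directed system of finitely generated modules of finite
projective dimension. -/
def IsDirectLimitOfFGFinProjDim (Λ : Type u) [Ring Λ] (M : ModuleCat.{u} Λ) : Prop :=
  ∃ (ι : Type u) (_ : Preorder ι) (_ : DecidableEq ι), Nonempty ι ∧ IsDirected ι (· ≤ ·) ∧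
    ∃ (G : ι → ModuleCat.{u} Λ) (f : ∀ i j : ι, i ≤ j → G i →ₗ[Λ] G j),
      DirectedSystem (fun i => G i) (fun i j h => f i j h) ∧
      (∀ i, Module.Finite Λ (G i) ∧ HasFinProjDim Λ (G i)) ∧
      Nonempty ((Module.DirectLimit (fun i => G i) f) ≃ₗ[Λ] M)

/-- A finite-dimensional associative unital algebra over `K`, bundled. -/
structure FDAlg (K : Type u) [Field K] : Type (u + 1) where
  carrier : Type u
  [ringInst : Ring carrier]
  [algInst : Algebra K carrier]
  [fdInst : FiniteDimensional K carrier]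

attribute [instance] FDAlg.ringInst FDAlg.algInst FDAlg.fdInst

namespace SquareRep

/-- The path algebra of the quiver with arrows `α, β : 1 → 2`, `σ, ζ : 2 → 3`, `γ : 3 → 1`
modulo the relations `σα = ζβ = γσ = αγ = βγ = 0` and `σβ = ζα`. The coordinates refer to the
basis `e₁, e₂, e₃, α, β, σ, ζ, γ, σβ, γζ`. -/
def Alg (K : Type u) : Type u := Fin 10 → K

namespace Alg

lemma ext_coord {K : Type u} {x y : Alg K} (h0 : x 0 = y 0) (h1 : x 1 = y 1) (h2 : x 2 = y 2)
    (h3 : x 3 = y 3) (h4 : x 4 = y 4) (h5 : x 5 = y 5) (h6 : x 6 = y 6) (h7 : x 7 = y 7)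
    (h8 : x 8 = y 8) (h9 : x 9 = y 9) : x = y := by
  funext i
  fin_cases i <;> assumption

variable {K : Type u} [Field K]

instance : AddCommGroup (Alg K) := inferInstanceAs (AddCommGroup (Fin 10 → K))

instance : Module K (Alg K) := inferInstanceAs (Module K (Fin 10 → K))

instance : FiniteDimensional K (Alg K) := inferInstanceAs (FiniteDimensional K (Fin 10 → K))

instance : Mul (Alg K) where
  mul x y :=
    ![x 0 * y 0, x 1 * y 1, x 2 * y 2,
      x 1 * y 3 + x 3 * y 0, x 1 * y 4 + x 4 * y 0,
      x 2 * y 5 + x 5 * y 1, x 2 * y 6 + x 6 * y 1,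
      x 0 * y 7 + x 7 * y 2,
      x 2 * y 8 + x 8 * y 0 + x 5 * y 4 + x 6 * y 3,
      x 0 * y 9 + x 9 * y 1 + x 7 * y 6]

instance : One (Alg K) where
  one := ![1, 1, 1, 0, 0, 0, 0, 0, 0, 0]

@[simp] lemma add_coord (x y : Alg K) (i : Fin 10) : (x + y) i = x i + y i := rfl
@[simp] lemma zero_coord (i : Fin 10) : (0 : Alg K) i = 0 := rfl
@[simp] lemma smul_coord (k : K) (x : Alg K) (i : Fin 10) : (k • x) i = k * x i := rfl

@[simp] lemma mul_coord_zero (x y : Alg K) : (x * y) 0 = x 0 * y 0 := rfl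
@[simp] lemma mul_coord_one (x y : Alg K) : (x * y) 1 = x 1 * y 1 := rfl
@[simp] lemma mul_coord_two (x y : Alg K) : (x * y) 2 = x 2 * y 2 := rfl
@[simp] lemma mul_coord_three (x y : Alg K) : (x * y) 3 = x 1 * y 3 + x 3 * y 0 := rfl
@[simp] lemma mul_coord_four (x y : Alg K) : (x * y) 4 = x 1 * y 4 + x 4 * y 0 := rfl
@[simp] lemma mul_coord_five (x y : Alg K) : (x * y) 5 = x 2 * y 5 + x 5 * y 1 := rfl
@[simp] lemma mul_coord_six (x y : Alg K) : (x * y) 6 = x 2 * y 6 + x 6 * y 1 := rfl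
@[simp] lemma mul_coord_seven (x y : Alg K) : (x * y) 7 = x 0 * y 7 + x 7 * y 2 := rfl
@[simp] lemma mul_coord_eight (x y : Alg K) :
    (x * y) 8 = x 2 * y 8 + x 8 * y 0 + x 5 * y 4 + x 6 * y 3 := rfl
@[simp] lemma mul_coord_nine (x y : Alg K) :
    (x * y) 9 = x 0 * y 9 + x 9 * y 1 + x 7 * y 6 := rfl

@[simp] lemma one_coord_zero : (1 : Alg K) 0 = 1 := rfl
@[simp] lemma one_coord_one : (1 : Alg K) 1 = 1 := rfl
@[simp] lemma one_coord_two : (1 : Alg K) 2 = 1 := rfl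
@[simp] lemma one_coord_three : (1 : Alg K) 3 = 0 := rfl
@[simp] lemma one_coord_four : (1 : Alg K) 4 = 0 := rfl
@[simp] lemma one_coord_five : (1 : Alg K) 5 = 0 := rfl
@[simp] lemma one_coord_six : (1 : Alg K) 6 = 0 := rfl
@[simp] lemma one_coord_seven : (1 : Alg K) 7 = 0 := rfl
@[simp] lemma one_coord_eight : (1 : Alg K) 8 = 0 := rfl
@[simp] lemma one_coord_nine : (1 : Alg K) 9 = 0 := rfl

instance : Ring (Alg K) :=
  { (inferInstance : AddCommGroup (Alg K)) with
    mul := (· * ·)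
    one := 1
    left_distrib := fun x y z => by apply ext_coord <;> simp <;> ring
    right_distrib := fun x y z => by apply ext_coord <;> simp <;> ring
    zero_mul := fun x => by apply ext_coord <;> simp
    mul_zero := fun x => by apply ext_coord <;> simp
    mul_assoc := fun x y z => by apply ext_coord <;> simp <;> ring
    one_mul := fun x => by apply ext_coord <;> simp
    mul_one := fun x => by apply ext_coord <;> simp }

instance : Algebra K (Alg K) :=
  Algebra.ofModule (fun k x y => by apply ext_coord <;> simp <;> ring)
    (fun k x y => by apply ext_coord <;> simp <;> ring)

/-- The element of the algebra with given coordinate vector supported at one index. -/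
def gen (i : Fin 10) : Alg K := (Pi.single i 1 : Fin 10 → K)

lemma gen_coord (i j : Fin 10) : (gen i : Alg K) j = if j = i then 1 else 0 := by
  simp [gen, Pi.single_apply]

/-- The sum of the arrows `α`, `σ` and `γ`, an element of square zero. -/
def diff : Alg K := gen 3 + gen 5 + gen 7

lemma exists_of_diff_mul_eq_zero (x : Alg K) (h : diff * x = 0) : ∃ y, x = diff * y := by
  have h' : ∀ i, (diff * x : Alg K) i = 0 := fun i => by rw [h]; rfl
  have h3 := h' 3
  have h5 := h' 5
  have h7 := h' 7
  have h8 := h' 8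
  have h9 := h' 9
  simp [diff, gen_coord] at h3 h5 h7 h8 h9
  refine ⟨x 3 • gen 0 + x 5 • gen 1 + x 7 • gen 2 + x 8 • gen 4 + x 9 • gen 6, ?_⟩
  apply ext_coord <;> simp [diff, gen_coord, h3, h5, h7, h8, h9]

lemma exists_of_zeta_mul_eq_zero (x : Alg K) (h₁ : gen 1 * x = x) (h : gen 6 * x = 0) :
    ∃ y, x = gen 4 * y := by
  have h₁' : ∀ i, (gen 1 * x : Alg K) i = x i := fun i => by rw [h₁]
  have h' : ∀ i, (gen 6 * x : Alg K) i = 0 := fun i => by rw [h]; rfl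
  have a0 := h₁' 0
  have a2 := h₁' 2
  have a5 := h₁' 5
  have a6 := h₁' 6
  have a7 := h₁' 7
  have a8 := h₁' 8
  have a9 := h₁' 9
  have h6 := h' 6
  have h8 := h' 8
  simp [gen_coord] at a0 a2 a5 a6 a7 a8 a9 h6 h8
  refine ⟨x 4 • gen 0, ?_⟩
  apply ext_coord <;> simp [gen_coord, ← a0, ← a2, ← a5, ← a6, ← a7, ← a8, ← a9, h6, h8]

lemma exists_of_beta_mul_eq_zero (x : Alg K) (h₁ : gen 0 * x = x) (h : gen 4 * x = 0) :
    ∃ y, x = gen 7 * y := by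
  have h₁' : ∀ i, (gen 0 * x : Alg K) i = x i := fun i => by rw [h₁]
  have h' : ∀ i, (gen 4 * x : Alg K) i = 0 := fun i => by rw [h]; rfl
  have a1 := h₁' 1
  have a2 := h₁' 2
  have a3 := h₁' 3
  have a4 := h₁' 4
  have a5 := h₁' 5
  have a6 := h₁' 6
  have a8 := h₁' 8
  have h4 := h' 4
  simp [gen_coord] at a1 a2 a3 a4 a5 a6 a8 h4
  refine ⟨x 7 • gen 2 + x 9 • gen 6, ?_⟩
  apply ext_coord <;> simp [gen_coord, ← a1, ← a2, ← a3, ← a4, ← a5, ← a6, ← a8, h4]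

end Alg

open Alg

/-- If left multiplications by `x₁, x₂` and `y` on the ring itself satisfy the exactness condition
that everything annihilated by `x₁` and `x₂` is a multiple of `y`, so do those on any projective
module. -/
lemma projective_exact {R P : Type*} [Ring R] [AddCommGroup P] [Module R P]
    [Module.Projective R P] {x₁ x₂ y : R}
    (hR : ∀ r : R, x₁ * r = 0 → x₂ * r = 0 → ∃ t, r = y * t) (p : P) (h₁ : x₁ • p = 0)
    (h₂ : x₂ • p = 0) : ∃ q : P, p = y • q := by
  classical
  obtain ⟨s, hs⟩ := Module.projective_def'.1 (inferInstance : Module.Projective R P)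
  have hcoord : ∀ {x : R}, x • p = 0 → ∀ i, x * s p i = 0 := fun {x} hx i => by
    have := congrArg (fun v => v i) (congrArg s hx)
    simpa using this
  choose t ht using fun i => hR (s p i) (hcoord h₁ i) (hcoord h₂ i)
  refine ⟨∑ i ∈ (s p).support, t i • i, ?_⟩
  have hp : p = Finsupp.linearCombination R id (s p) := (LinearMap.congr_fun hs p).symm
  conv_lhs => rw [hp, Finsupp.linearCombination_apply, Finsupp.sum]
  rw [Finset.smul_sum]
  refine Finset.sum_congr rfl fun i _ => ?_
  rw [smul_smul, ← ht]
  rfl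

section Exactness

variable {K : Type u} [Field K]

/-- The square-zero element `diff` acts exactly on `M`. -/
def DiffExact (K : Type u) [Field K] (M : Type*) [AddCommGroup M] [Module (Alg K) M] : Prop :=
  ∀ m : M, (diff : Alg K) • m = 0 → ∃ n : M, m = (diff : Alg K) • n

lemma diff_mul_diff : (diff * diff : Alg K) = 0 := by
  apply ext_coord <;> simp [diff, gen_coord]

lemma DiffExact.of_projective (M : Type*) [AddCommGroup M] [Module (Alg K) M]
    [Module.Projective (Alg K) M] : DiffExact K M := fun m h =>
  projective_exact (fun r hr _ => exists_of_diff_mul_eq_zero r hr) m h h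

lemma DiffExact.of_ker {P M : Type*} [AddCommGroup P] [Module (Alg K) P] [AddCommGroup M]
    [Module (Alg K) M] (g : P →ₗ[Alg K] M) (hg : Function.Surjective g) (hP : DiffExact K P)
    (hN : DiffExact K (LinearMap.ker g)) : DiffExact K M := by
  intro m hm
  obtain ⟨p, rfl⟩ := hg m
  obtain ⟨n, hn⟩ := hN ⟨(diff : Alg K) • p, by simpa using hm⟩
    (Subtype.ext (by simp [smul_smul, diff_mul_diff]))
  have hn' : (diff : Alg K) • p = (diff : Alg K) • (n : P) := congrArg Subtype.val hn
  obtain ⟨q, hq⟩ := hP (p - n) (by rw [smul_sub, hn', sub_self])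
  refine ⟨g q, ?_⟩
  rw [← map_smul, ← hq, map_sub, LinearMap.mem_ker.1 n.2, sub_zero]

lemma DiffExact.of_hasProjDimLE : ∀ (n : ℕ) (M : ModuleCat.{u} (Alg K)),
    HasProjDimLE (Alg K) n M → DiffExact K M
  | 0, _, h => by
    have : Module.Projective (Alg K) _ := h
    exact DiffExact.of_projective _
  | n + 1, _, ⟨P, g, hP, hg, hN⟩ => by
    have := hP
    exact DiffExact.of_ker g hg (DiffExact.of_projective P) (DiffExact.of_hasProjDimLE n _ hN)

/-- In a projective module, an element of the first vertex space killed by `β` lies in the image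
of `γ`. -/
lemma exists_gamma_of_projective {M : Type*} [AddCommGroup M] [Module (Alg K) M]
    [Module.Projective (Alg K) M] (m : M) (h₁ : (gen 0 : Alg K) • m = m)
    (h : (gen 4 : Alg K) • m = 0) : ∃ n : M, m = (gen 7 : Alg K) • n :=
  projective_exact (x₁ := 1 - gen 0)
    (fun r hr hr' => exists_of_beta_mul_eq_zero r
      (by rw [sub_mul, one_mul, sub_eq_zero] at hr; exact hr.symm) hr')
    m (by rw [sub_smul, one_smul, h₁, sub_self]) h

/-- In a projective module, an element of the second vertex space killed by `ζ` lies in the image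
of `β`. -/
lemma exists_beta_of_projective {M : Type*} [AddCommGroup M] [Module (Alg K) M]
    [Module.Projective (Alg K) M] (m : M) (h₁ : (gen 1 : Alg K) • m = m)
    (h : (gen 6 : Alg K) • m = 0) : ∃ n : M, m = (gen 4 : Alg K) • n :=
  projective_exact (x₁ := 1 - gen 1)
    (fun r hr hr' => exists_of_zeta_mul_eq_zero r
      (by rw [sub_mul, one_mul, sub_eq_zero] at hr; exact hr.symm) hr')
    m (by rw [sub_smul, one_smul, h₁, sub_self]) h

lemma gen_mul_gen : (gen 0 * gen 0 : Alg K) = gen 0 ∧ (gen 1 * gen 4 : Alg K) = gen 4 ∧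
    (gen 6 * gen 4 : Alg K) = 0 ∧ (gen 4 * gen 0 : Alg K) = gen 4 := by
  refine ⟨?_, ?_, ?_, ?_⟩ <;> apply ext_coord <;> simp [gen_coord]

lemma exists_gamma_of_ker {P M : Type*} [AddCommGroup P] [Module (Alg K) P] [AddCommGroup M]
    [Module (Alg K) M] (g : P →ₗ[Alg K] M) (hg : Function.Surjective g)
    [Module.Projective (Alg K) P] [Module.Projective (Alg K) (LinearMap.ker g)]
    (m : M) (h₁ : (gen 0 : Alg K) • m = m) (h : (gen 4 : Alg K) • m = 0) :
    ∃ n : M, m = (gen 7 : Alg K) • n := by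
  obtain ⟨e00, e14, e64, e40⟩ := gen_mul_gen (K := K)
  obtain ⟨p, rfl⟩ := hg m
  obtain ⟨q, hq⟩ := exists_beta_of_projective (K := K) (M := LinearMap.ker g)
    ⟨(gen 4 : Alg K) • p, by simpa using h⟩
    (Subtype.ext (by simp [smul_smul, e14])) (Subtype.ext (by simp [smul_smul, e64]))
  have hq' : (gen 4 : Alg K) • p = (gen 4 : Alg K) • (q : P) := congrArg Subtype.val hq
  obtain ⟨n, hn⟩ := exists_gamma_of_projective ((gen 0 : Alg K) • (p - q))
    (by rw [smul_smul, e00]) (by rw [smul_smul, e40, smul_sub, hq', sub_self])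
  refine ⟨g n, ?_⟩
  rw [← map_smul, ← hn, map_smul, map_sub, LinearMap.mem_ker.1 q.2, sub_zero, h₁]

/-- The property of `exists_gamma_of_projective` holds for modules of projective dimension at
most one. -/
lemma exists_gamma_of_hasProjDimLE_one (M : ModuleCat.{u} (Alg K))
    (hM : HasProjDimLE (Alg K) 1 M) (m : M) (h₁ : (gen 0 : Alg K) • m = m)
    (h : (gen 4 : Alg K) • m = 0) : ∃ n : M, m = (gen 7 : Alg K) • n := by
  obtain ⟨P, g, hP, hg, hN⟩ := hM
  have : Module.Projective (Alg K) (LinearMap.ker g) := hN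
  exact exists_gamma_of_ker g hg m h₁ h

end Exactness

/-- A representation of the quiver with relations defining `Alg K`. -/
structure QuiverRep (K : Type u) [Field K] where
  V₁ : Type u
  V₂ : Type u
  V₃ : Type u
  [addCommGroup₁ : AddCommGroup V₁]
  [addCommGroup₂ : AddCommGroup V₂]
  [addCommGroup₃ : AddCommGroup V₃]
  [module₁ : Module K V₁]
  [module₂ : Module K V₂]
  [module₃ : Module K V₃]
  α : V₁ →ₗ[K] V₂
  β : V₁ →ₗ[K] V₂
  σ : V₂ →ₗ[K] V₃
  ζ : V₂ →ₗ[K] V₃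
  γ : V₃ →ₗ[K] V₁
  σα : ∀ x, σ (α x) = 0
  ζβ : ∀ x, ζ (β x) = 0
  σβ : ∀ x, σ (β x) = ζ (α x)
  γσ : ∀ x, γ (σ x) = 0
  αγ : ∀ x, α (γ x) = 0
  βγ : ∀ x, β (γ x) = 0

namespace QuiverRep

attribute [instance] addCommGroup₁ addCommGroup₂ addCommGroup₃ module₁ module₂ module₃
attribute [simp] σα ζβ σβ γσ αγ βγ

variable {K : Type u} [Field K]

/-- The underlying space of the module corresponding to a representation. -/
def Total (R : QuiverRep K) : Type u := R.V₁ × R.V₂ × R.V₃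

variable (R S : QuiverRep K)

variable {R} in
/-- The element of the total space with given components. -/
def tot (x : R.V₁) (y : R.V₂) (z : R.V₃) : R.Total := (x, y, z)

@[simp] lemma tot_fst (x : R.V₁) (y : R.V₂) (z : R.V₃) : (tot x y z).1 = x := rfl
@[simp] lemma tot_snd_fst (x : R.V₁) (y : R.V₂) (z : R.V₃) : (tot x y z).2.1 = y := rfl
@[simp] lemma tot_snd_snd (x : R.V₁) (y : R.V₂) (z : R.V₃) : (tot x y z).2.2 = z := rfl

instance : AddCommGroup R.Total := inferInstanceAs (AddCommGroup (R.V₁ × R.V₂ × R.V₃))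

instance : Module K R.Total := inferInstanceAs (Module K (R.V₁ × R.V₂ × R.V₃))

@[simp] lemma add_fst (x y : R.Total) : (x + y).1 = x.1 + y.1 := rfl
@[simp] lemma add_snd_fst (x y : R.Total) : (x + y).2.1 = x.2.1 + y.2.1 := rfl
@[simp] lemma add_snd_snd (x y : R.Total) : (x + y).2.2 = x.2.2 + y.2.2 := rfl
@[simp] lemma zero_fst : (0 : R.Total).1 = 0 := rfl
@[simp] lemma zero_snd_fst : (0 : R.Total).2.1 = 0 := rfl
@[simp] lemma zero_snd_snd : (0 : R.Total).2.2 = 0 := rfl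
@[simp] lemma scalar_fst (k : K) (x : R.Total) : (k • x).1 = k • x.1 := rfl
@[simp] lemma scalar_snd_fst (k : K) (x : R.Total) : (k • x).2.1 = k • x.2.1 := rfl
@[simp] lemma scalar_snd_snd (k : K) (x : R.Total) : (k • x).2.2 = k • x.2.2 := rfl

instance : SMul (Alg K) R.Total where
  smul l x := (l 0 • x.1 + l 7 • R.γ x.2.2 + l 9 • R.γ (R.ζ x.2.1),
    l 1 • x.2.1 + l 3 • R.α x.1 + l 4 • R.β x.1,
    l 2 • x.2.2 + l 5 • R.σ x.2.1 + l 6 • R.ζ x.2.1 + l 8 • R.ζ (R.α x.1))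

@[simp] lemma smul_fst (l : Alg K) (x : R.Total) :
    (l • x).1 = l 0 • x.1 + l 7 • R.γ x.2.2 + l 9 • R.γ (R.ζ x.2.1) := rfl
@[simp] lemma smul_snd_fst (l : Alg K) (x : R.Total) :
    (l • x).2.1 = l 1 • x.2.1 + l 3 • R.α x.1 + l 4 • R.β x.1 := rfl
@[simp] lemma smul_snd_snd (l : Alg K) (x : R.Total) :
    (l • x).2.2 = l 2 • x.2.2 + l 5 • R.σ x.2.1 + l 6 • R.ζ x.2.1 + l 8 • R.ζ (R.α x.1) := rfl

variable {R S}

lemma total_ext {x y : R.Total} (h₁ : x.1 = y.1) (h₂ : x.2.1 = y.2.1) (h₃ : x.2.2 = y.2.2) :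
    x = y :=
  Prod.ext h₁ (Prod.ext h₂ h₃)

lemma gamma_zeta_alpha (x : R.V₁) : R.γ (R.ζ (R.α x)) = 0 := by rw [← R.σβ, R.γσ]

attribute [simp] gamma_zeta_alpha

instance : Module (Alg K) R.Total where
  one_smul x := by apply total_ext <;> simp
  mul_smul l m x := by apply total_ext <;> simp <;> module
  smul_zero l := by apply total_ext <;> simp
  smul_add l x y := by apply total_ext <;> simp <;> module
  add_smul l m x := by apply total_ext <;> simp <;> module
  zero_smul x := by apply total_ext <;> simp

instance : IsScalarTower K (Alg K) R.Total where
  smul_assoc k l x := by apply total_ext <;> simp <;> module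

/-- The module map given by a morphism of representations. -/
def homMk (f₁ : R.V₁ →ₗ[K] S.V₁) (f₂ : R.V₂ →ₗ[K] S.V₂) (f₃ : R.V₃ →ₗ[K] S.V₃)
    (hα : ∀ x, f₂ (R.α x) = S.α (f₁ x)) (hβ : ∀ x, f₂ (R.β x) = S.β (f₁ x))
    (hσ : ∀ x, f₃ (R.σ x) = S.σ (f₂ x)) (hζ : ∀ x, f₃ (R.ζ x) = S.ζ (f₂ x))
    (hγ : ∀ x, f₁ (R.γ x) = S.γ (f₃ x)) : R.Total →ₗ[Alg K] S.Total where
  toFun x := tot (f₁ x.1) (f₂ x.2.1) (f₃ x.2.2)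
  map_add' x y := by apply total_ext <;> simp
  map_smul' l x := by apply total_ext <;> simp [hα, hβ, hσ, hζ, hγ]

section Free

variable (A B C : Type u) [AddCommGroup A] [AddCommGroup B] [AddCommGroup C]
  [Module K A] [Module K B] [Module K C]

/-- The representation freely generated by the spaces `A`, `B` and `C` at the three vertices. The
components at the first vertex are `A, γζB, γC`, those at the second one `αA, βA, B`, and those at
the third one `σβA, σB, ζB, C`. -/
abbrev free : QuiverRep K where
  V₁ := A × B × C
  V₂ := A × A × B
  V₃ := A × B × B × C
  α := LinearMap.inl K A (A × B) ∘ₗ LinearMap.fst K A (B × C)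
  β := LinearMap.inr K A (A × B) ∘ₗ LinearMap.inl K A B ∘ₗ LinearMap.fst K A (B × C)
  σ :=
    { toFun := fun v => (v.2.1, v.2.2, 0, 0)
      map_add' := by simp
      map_smul' := by simp }
  ζ :=
    { toFun := fun v => (v.1, 0, v.2.2, 0)
      map_add' := by simp
      map_smul' := by simp }
  γ := LinearMap.inr K A (B × C) ∘ₗ LinearMap.snd K B (B × C) ∘ₗ LinearMap.snd K A (B × B × C)
  σα := by simp
  ζβ := by simp
  σβ := by simp
  γσ := by simp
  αγ := by simp
  βγ := by simp

variable {A B C}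

/-- The element of the free representation with given components. -/
def freeMk (a₁ : A) (b₁ : B) (c₁ : C) (a₂ a₂' : A) (b₂ : B) (a₃ : A) (b₃ b₃' : B) (c₃ : C) :
    (free (K := K) A B C).Total :=
  tot (R := free A B C) (a₁, b₁, c₁) (a₂, a₂', b₂) (a₃, b₃, b₃', c₃)

/-- The map out of a free representation determined by the images of the generators. -/
def freeHom {R : QuiverRep K} (fA : A →ₗ[K] R.V₁) (fB : B →ₗ[K] R.V₂) (fC : C →ₗ[K] R.V₃) :
    (free (K := K) A B C).Total →ₗ[Alg K] R.Total :=
  homMk (R := free A B C)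
    (fA.coprod ((R.γ ∘ₗ R.ζ ∘ₗ fB).coprod (R.γ ∘ₗ fC)))
    ((R.α ∘ₗ fA).coprod ((R.β ∘ₗ fA).coprod fB))
    ((R.ζ ∘ₗ R.α ∘ₗ fA).coprod ((R.σ ∘ₗ fB).coprod ((R.ζ ∘ₗ fB).coprod fC)))
    (by rintro ⟨a, b, c⟩; simp)
    (by rintro ⟨a, b, c⟩; simp)
    (by rintro ⟨a, a', b⟩; simp)
    (by rintro ⟨a, a', b⟩; simp)
    (by rintro ⟨a, b, b', c⟩; simp)

lemma freeHom_freeMk {R : QuiverRep K} (fA : A →ₗ[K] R.V₁) (fB : B →ₗ[K] R.V₂)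
    (fC : C →ₗ[K] R.V₃) (a₁ : A) (b₁ : B) (c₁ : C) (a₂ a₂' : A) (b₂ : B) (a₃ : A) (b₃ b₃' : B)
    (c₃ : C) :
    freeHom fA fB fC (freeMk a₁ b₁ c₁ a₂ a₂' b₂ a₃ b₃ b₃' c₃) =
      tot (fA a₁ + (R.γ (R.ζ (fB b₁)) + R.γ (fC c₁))) (R.α (fA a₂) + (R.β (fA a₂') + fB b₂))
        (R.ζ (R.α (fA a₃)) + (R.σ (fB b₃) + (R.ζ (fB b₃') + fC c₃))) :=
  rfl

lemma free_decomp (a₁ : A) (b₁ : B) (c₁ : C) (a₂ a₂' : A) (b₂ : B) (a₃ : A) (b₃ b₃' : B) (c₃ : C) :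
    (freeMk a₁ b₁ c₁ a₂ a₂' b₂ a₃ b₃ b₃' c₃ : (free (K := K) A B C).Total) =
      freeMk a₁ 0 0 0 0 0 0 0 0 0 + (gen 3 : Alg K) • freeMk a₂ 0 0 0 0 0 0 0 0 0 +
      (gen 4 : Alg K) • freeMk a₂' 0 0 0 0 0 0 0 0 0 +
      (gen 8 : Alg K) • freeMk a₃ 0 0 0 0 0 0 0 0 0 +
      (freeMk 0 0 0 0 0 b₂ 0 0 0 0 + (gen 5 : Alg K) • freeMk 0 0 0 0 0 b₃ 0 0 0 0 +
      (gen 6 : Alg K) • freeMk 0 0 0 0 0 b₃' 0 0 0 0 +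
      (gen 9 : Alg K) • freeMk 0 0 0 0 0 b₁ 0 0 0 0) +
      (freeMk 0 0 0 0 0 0 0 0 0 c₃ + (gen 7 : Alg K) • freeMk 0 0 0 0 0 0 0 0 0 c₁) := by
  apply total_ext <;> simp [freeMk, gen_coord]

lemma free_hom_ext {N : Type*} [AddCommGroup N] [Module (Alg K) N]
    {f g : (free (K := K) A B C).Total →ₗ[Alg K] N}
    (hA : ∀ a, f (freeMk a 0 0 0 0 0 0 0 0 0) = g (freeMk a 0 0 0 0 0 0 0 0 0))
    (hB : ∀ b, f (freeMk 0 0 0 0 0 b 0 0 0 0) = g (freeMk 0 0 0 0 0 b 0 0 0 0))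
    (hC : ∀ c, f (freeMk 0 0 0 0 0 0 0 0 0 c) = g (freeMk 0 0 0 0 0 0 0 0 0 c)) : f = g := by
  refine LinearMap.ext ?_
  rintro ⟨⟨a₁, b₁, c₁⟩, ⟨a₂, a₂', b₂⟩, ⟨a₃, b₃, b₃', c₃⟩⟩
  change f (freeMk a₁ b₁ c₁ a₂ a₂' b₂ a₃ b₃ b₃' c₃) = g (freeMk a₁ b₁ c₁ a₂ a₂' b₂ a₃ b₃ b₃' c₃)
  rw [free_decomp]
  simp only [map_add, map_smul, hA, hB, hC]

end Free

section OfModule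

variable (M : Type u) [AddCommGroup M] [Module K M] [Module (Alg K) M] [IsScalarTower K (Alg K) M]

/-- The space at the vertex belonging to the idempotent `gen i`. -/
def vertex (i : Fin 10) : Submodule K M :=
  LinearMap.eqLocus (Algebra.lsmul K K M (gen i : Alg K)) LinearMap.id

variable {M} in
lemma mem_vertex {i : Fin 10} {m : M} : m ∈ vertex (K := K) M i ↔ (gen i : Alg K) • m = m := Iff.rfl

/-- The action of an arrow `gen k` from the vertex `i` to the vertex `j`. -/
def arrow (i j k : Fin 10) (h : (gen j * gen k : Alg K) = gen k) :
    vertex (K := K) M i →ₗ[K] vertex (K := K) M j :=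
  ((Algebra.lsmul K K M (gen k : Alg K)).domRestrict _).codRestrict _
    fun m => mem_vertex.2 (by
      change (gen j : Alg K) • (gen k : Alg K) • (m : M) = (gen k : Alg K) • (m : M)
      rw [smul_smul, h])

lemma coe_arrow (i j k : Fin 10) (h : (gen j * gen k : Alg K) = gen k) (m : vertex (K := K) M i) :
    (arrow M i j k h m : M) = (gen k : Alg K) • (m : M) := rfl

/-- The representation on the vertex spaces of a module. -/
def ofModule : QuiverRep K where
  V₁ := vertex (K := K) M 0
  V₂ := vertex (K := K) M 1
  V₃ := vertex (K := K) M 2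
  α := arrow M 0 1 3 (by apply ext_coord <;> simp [gen_coord])
  β := arrow M 0 1 4 (by apply ext_coord <;> simp [gen_coord])
  σ := arrow M 1 2 5 (by apply ext_coord <;> simp [gen_coord])
  ζ := arrow M 1 2 6 (by apply ext_coord <;> simp [gen_coord])
  γ := arrow M 2 0 7 (by apply ext_coord <;> simp [gen_coord])
  σα x := Subtype.ext (by
    rw [coe_arrow, coe_arrow, smul_smul,
      show (gen 5 * gen 3 : Alg K) = 0 by apply ext_coord <;> simp [gen_coord], zero_smul]; rfl)
  ζβ x := Subtype.ext (by
    rw [coe_arrow, coe_arrow, smul_smul,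
      show (gen 6 * gen 4 : Alg K) = 0 by apply ext_coord <;> simp [gen_coord], zero_smul]; rfl)
  σβ x := Subtype.ext (by
    rw [coe_arrow, coe_arrow, coe_arrow, coe_arrow, smul_smul, smul_smul,
      show (gen 5 * gen 4 : Alg K) = gen 6 * gen 3 by apply ext_coord <;> simp [gen_coord]])
  γσ x := Subtype.ext (by
    rw [coe_arrow, coe_arrow, smul_smul,
      show (gen 7 * gen 5 : Alg K) = 0 by apply ext_coord <;> simp [gen_coord], zero_smul]; rfl)
  αγ x := Subtype.ext (by
    rw [coe_arrow, coe_arrow, smul_smul,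
      show (gen 3 * gen 7 : Alg K) = 0 by apply ext_coord <;> simp [gen_coord], zero_smul]; rfl)
  βγ x := Subtype.ext (by
    rw [coe_arrow, coe_arrow, smul_smul,
      show (gen 4 * gen 7 : Alg K) = 0 by apply ext_coord <;> simp [gen_coord], zero_smul]; rfl)

lemma mul_vertex (l : Alg K) :
    l * gen 0 = l 0 • gen 0 + l 3 • gen 3 + l 4 • gen 4 + l 8 • (gen 6 * gen 3) ∧
    l * gen 1 = l 1 • gen 1 + l 5 • gen 5 + l 6 • gen 6 + l 9 • (gen 7 * gen 6) ∧
    l * gen 2 = l 2 • gen 2 + l 7 • gen 7 := by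
  refine ⟨?_, ?_, ?_⟩ <;> apply ext_coord <;> simp [gen_coord]

lemma vertex_mul_vertex :
    (gen 0 * gen 0 : Alg K) = gen 0 ∧ (gen 1 * gen 1 : Alg K) = gen 1 ∧
    (gen 2 * gen 2 : Alg K) = gen 2 ∧ (gen 0 * gen 1 : Alg K) = 0 ∧ (gen 0 * gen 2 : Alg K) = 0 ∧
    (gen 1 * gen 0 : Alg K) = 0 ∧ (gen 1 * gen 2 : Alg K) = 0 ∧ (gen 2 * gen 0 : Alg K) = 0 ∧
    (gen 2 * gen 1 : Alg K) = 0 ∧ (gen 0 + gen 1 + gen 2 : Alg K) = 1 := by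
  refine ⟨?_, ?_, ?_, ?_, ?_, ?_, ?_, ?_, ?_, ?_⟩ <;> apply ext_coord <;> simp [gen_coord]

/-- The sum of the vertex spaces maps to the module. -/
def ofModuleHom : (ofModule (K := K) M).Total →ₗ[Alg K] M where
  toFun x := x.1.1 + x.2.1.1 + x.2.2.1
  map_add' x y := by
    change (x.1.1 + y.1.1) + (x.2.1.1 + y.2.1.1) + (x.2.2.1 + y.2.2.1) = _
    abel
  map_smul' l x := by
    obtain ⟨⟨x, hx⟩, ⟨y, hy⟩, ⟨z, hz⟩⟩ := x
    obtain ⟨h₁, h₂, h₃⟩ := mul_vertex l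
    change (l 0 • x + l 7 • (gen 7 : Alg K) • z + l 9 • (gen 7 : Alg K) • (gen 6 : Alg K) • y) +
      (l 1 • y + l 3 • (gen 3 : Alg K) • x + l 4 • (gen 4 : Alg K) • x) +
      (l 2 • z + l 5 • (gen 5 : Alg K) • y + l 6 • (gen 6 : Alg K) • y +
        l 8 • (gen 6 : Alg K) • (gen 3 : Alg K) • x) = l • (x + y + z)
    rw [mem_vertex] at hx hy hz
    have ex : l • x = (l * gen 0) • x := by rw [mul_smul, hx]
    have ey : l • y = (l * gen 1) • y := by rw [mul_smul, hy]
    have ez : l • z = (l * gen 2) • z := by rw [mul_smul, hz]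
    rw [smul_add, smul_add, ex, ey, ez, h₁, h₂, h₃]
    simp only [add_smul, smul_assoc, mul_smul, hx, hy, hz]
    abel

/-- A module is isomorphic to the sum of its vertex spaces. -/
noncomputable def ofModuleEquiv : (ofModule (K := K) M).Total ≃ₗ[Alg K] M := by
  obtain ⟨e00, e11, e22, e01, e02, e10, e12, e20, e21, esum⟩ := vertex_mul_vertex (K := K)
  refine LinearEquiv.ofBijective (ofModuleHom M) ⟨?_, fun m => ?_⟩
  · rw [← LinearMap.ker_eq_bot, LinearMap.ker_eq_bot']
    rintro ⟨⟨x, hx⟩, ⟨y, hy⟩, ⟨z, hz⟩⟩ h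
    change x + y + z = 0 at h
    rw [mem_vertex] at hx hy hz
    have key : ∀ i : Fin 10, (gen i * gen 0 : Alg K) • x + (gen i * gen 1 : Alg K) • y +
        (gen i * gen 2 : Alg K) • z = 0 := fun i => by
      rw [mul_smul, mul_smul, mul_smul, hx, hy, hz, ← smul_add, ← smul_add, h, smul_zero]
    have k0 := key 0
    have k1 := key 1
    have k2 := key 2
    rw [e00, e01, e02, zero_smul, zero_smul, add_zero, add_zero, hx] at k0
    rw [e10, e11, e12, zero_smul, zero_smul, zero_add, add_zero, hy] at k1
    rw [e20, e21, e22, zero_smul, zero_smul, zero_add, zero_add, hz] at k2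
    subst k0 k1 k2
    rfl
  · refine ⟨tot (R := ofModule M) ⟨(gen 0 : Alg K) • m, ?_⟩ ⟨(gen 1 : Alg K) • m, ?_⟩
      ⟨(gen 2 : Alg K) • m, ?_⟩, ?_⟩
    · rw [mem_vertex, smul_smul, e00]
    · rw [mem_vertex, smul_smul, e11]
    · rw [mem_vertex, smul_smul, e22]
    · change (gen 0 : Alg K) • m + (gen 1 : Alg K) • m + (gen 2 : Alg K) • m = m
      rw [← add_smul, ← add_smul, esum, one_smul]

end OfModule

section Projective

variable {A B C : Type u} [AddCommGroup A] [AddCommGroup B] [AddCommGroup C]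
  [Module K A] [Module K B] [Module K C]

/-- The projection of a module onto a vertex space. -/
def vertexProj (M : Type u) [AddCommGroup M] [Module K M] [Module (Alg K) M]
    [IsScalarTower K (Alg K) M] (i : Fin 10) (h : (gen i * gen i : Alg K) = gen i) :
    M →ₗ[K] vertex (K := K) M i :=
  (Algebra.lsmul K K M (gen i : Alg K)).codRestrict _ fun m => mem_vertex.2 (by
    change (gen i : Alg K) • (gen i : Alg K) • m = (gen i : Alg K) • m
    rw [smul_smul, h])

instance free_projective : Module.Projective (Alg K) (free (K := K) A B C).Total := by
  obtain ⟨e00, e11, e22, -⟩ := vertex_mul_vertex (K := K)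
  refine Module.Projective.of_lifting_property'' fun f hf => ?_
  obtain ⟨r, hr⟩ := (f.restrictScalars K).exists_rightInverse_of_surjective
    (LinearMap.range_eq_top.2 hf)
  have hr' : ∀ x, f (r x) = x := LinearMap.congr_fun hr
  let ιA : A →ₗ[K] (free (K := K) A B C).Total :=
    { toFun := fun a => freeMk a 0 0 0 0 0 0 0 0 0
      map_add' := fun x y => by apply total_ext <;> simp [freeMk]
      map_smul' := fun k x => by apply total_ext <;> simp [freeMk] }
  let ιB : B →ₗ[K] (free (K := K) A B C).Total :=
    { toFun := fun b => freeMk 0 0 0 0 0 b 0 0 0 0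
      map_add' := fun x y => by apply total_ext <;> simp [freeMk]
      map_smul' := fun k x => by apply total_ext <;> simp [freeMk] }
  let ιC : C →ₗ[K] (free (K := K) A B C).Total :=
    { toFun := fun c => freeMk 0 0 0 0 0 0 0 0 0 c
      map_add' := fun x y => by apply total_ext <;> simp [freeMk]
      map_smul' := fun k x => by apply total_ext <;> simp [freeMk] }
  let F := (free (K := K) A B C).Total →₀ Alg K
  have hsum : ∀ x y z, ofModuleHom (K := K) F (tot x y z) = x.1 + y.1 + z.1 := fun _ _ _ => rfl
  refine ⟨ofModuleHom (K := K) F ∘ₗ freeHom (R := ofModule F) (vertexProj F 0 e00 ∘ₗ r ∘ₗ ιA)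
    (vertexProj F 1 e11 ∘ₗ r ∘ₗ ιB) (vertexProj F 2 e22 ∘ₗ r ∘ₗ ιC), free_hom_ext ?_ ?_ ?_⟩
  · intro a
    have h : (gen 0 : Alg K) • ιA a = ιA a := by
      apply total_ext <;> simp [ιA, freeMk, gen_coord] <;> rfl
    rw [LinearMap.comp_apply, LinearMap.comp_apply, freeHom_freeMk, hsum]
    simp only [map_zero, add_zero]
    change f ((gen 0 : Alg K) • r (ιA a) + 0 + 0) = ιA a
    rw [add_zero, add_zero, map_smul, hr', h]
  · intro b
    have h : (gen 1 : Alg K) • ιB b = ιB b := by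
      apply total_ext <;> simp [ιB, freeMk, gen_coord] <;> rfl
    rw [LinearMap.comp_apply, LinearMap.comp_apply, freeHom_freeMk, hsum]
    simp only [map_zero, add_zero, zero_add]
    change f (0 + (gen 1 : Alg K) • r (ιB b) + 0) = ιB b
    rw [add_zero, zero_add, map_smul, hr', h]
  · intro c
    have h : (gen 2 : Alg K) • ιC c = ιC c := by
      apply total_ext <;> simp [ιC, freeMk, gen_coord] <;> rfl
    rw [LinearMap.comp_apply, LinearMap.comp_apply, freeHom_freeMk, hsum]
    simp only [map_zero, add_zero, zero_add]
    change f (0 + 0 + (gen 2 : Alg K) • r (ιC c)) = ιC c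
    rw [add_zero, zero_add, map_smul, hr', h]

end Projective

lemma hasProjDimLE_two_of_exact {Λ P₀ P₁ P₂ M : Type u} [Ring Λ] [AddCommGroup P₀] [Module Λ P₀]
    [AddCommGroup P₁] [Module Λ P₁] [AddCommGroup P₂] [Module Λ P₂] [AddCommGroup M] [Module Λ M]
    [Module.Projective Λ P₀] [Module.Projective Λ P₁] [Module.Projective Λ P₂]
    (d₂ : P₂ →ₗ[Λ] P₁) (d₁ : P₁ →ₗ[Λ] P₀) (d₀ : P₀ →ₗ[Λ] M) (h₂ : Function.Injective d₂)
    (h₂₁ : Function.Exact d₂ d₁) (h₁₀ : Function.Exact d₁ d₀) (h₀ : Function.Surjective d₀) :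
    HasProjDimLE Λ 2 (ModuleCat.of Λ M) := by
  let d : P₁ →ₗ[Λ] LinearMap.ker d₀ := d₁.codRestrict _ h₁₀.apply_apply_eq_zero
  have hd : Function.Surjective d := fun ⟨x, hx⟩ => by
    obtain ⟨y, hy⟩ := (h₁₀ x).1 hx
    exact ⟨y, Subtype.ext hy⟩
  let e : P₂ →ₗ[Λ] LinearMap.ker d :=
    d₂.codRestrict _ fun x => Subtype.ext (h₂₁.apply_apply_eq_zero x)
  have he : Function.Bijective e := by
    refine ⟨fun x y h => h₂ (congrArg Subtype.val h), fun ⟨x, hx⟩ => ?_⟩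
    obtain ⟨y, hy⟩ := (h₂₁ x).1 (congrArg Subtype.val hx)
    exact ⟨y, Subtype.ext hy⟩
  exact ⟨ModuleCat.of Λ P₀, d₀, ‹_›, h₀, ModuleCat.of Λ P₁, d, ‹_›, hd,
    Module.Projective.of_equiv (LinearEquiv.ofBijective e he)⟩

section Normal

variable {U₁ U₂ U₃ : Type u} [AddCommGroup U₁] [AddCommGroup U₂] [AddCommGroup U₃]
  [Module K U₁] [Module K U₂] [Module K U₃]

/-- The normal form of the representations on which `diff` acts exactly. -/
abbrev normal (p : U₁ →ₗ[K] U₂) (q : U₁ →ₗ[K] U₁) (f : U₂ →ₗ[K] U₃) (g : U₂ →ₗ[K] U₂)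
    (hf : ∀ u, f (p u) = 0) (hg : ∀ u, g (p u) + p (q u) = 0) : QuiverRep K where
  V₁ := U₁ × U₃
  V₂ := U₂ × U₁
  V₃ := U₃ × U₂
  α := LinearMap.inr K U₂ U₁ ∘ₗ LinearMap.fst K U₁ U₃
  β := p.prod q ∘ₗ LinearMap.fst K U₁ U₃
  σ := LinearMap.inr K U₃ U₂ ∘ₗ LinearMap.fst K U₂ U₁
  ζ := (f.prod g).coprod (LinearMap.inr K U₃ U₂ ∘ₗ p)
  γ := LinearMap.inr K U₁ U₃ ∘ₗ LinearMap.fst K U₃ U₂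
  σα := by simp
  ζβ := by simp [hf, hg]
  σβ := by simp
  γσ := by simp
  αγ := by simp
  βγ := by simp

variable (p : U₁ →ₗ[K] U₂) (q : U₁ →ₗ[K] U₁) (f : U₂ →ₗ[K] U₃) (g : U₂ →ₗ[K] U₂)
    (hf : ∀ u, f (p u) = 0) (hg : ∀ u, g (p u) + p (q u) = 0)

/-- The projective cover in the resolution of `normal`. -/
def resolution₀ : (free (K := K) U₁ U₂ U₃).Total →ₗ[Alg K] (normal p q f g hf hg).Total :=
  freeHom (R := normal p q f g hf hg) (LinearMap.inl K U₁ U₃) (LinearMap.inl K U₂ U₁)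
    (LinearMap.inl K U₃ U₂)

/-- The first differential in the resolution of `normal`. -/
def resolution₁ :
    (free (K := K) PUnit.{u + 1} U₁ U₂).Total →ₗ[Alg K] (free (K := K) U₁ U₂ U₃).Total :=
  freeHom (R := free U₁ U₂ U₃) 0 ((-q).prod (LinearMap.id.prod (-p)))
    ((0 : U₂ →ₗ[K] U₁).prod ((-g).prod (LinearMap.id.prod (-f))))

/-- The second differential in the resolution of `normal`. -/
def resolution₂ :
    (free (K := K) PUnit.{u + 1} PUnit.{u + 1} U₁).Total →ₗ[Alg K]
      (free (K := K) PUnit.{u + 1} U₁ U₂).Total :=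
  freeHom (R := free PUnit.{u + 1} U₁ U₂) 0 0
    ((0 : U₁ →ₗ[K] PUnit.{u + 1}).prod (q.prod (LinearMap.id.prod p)))

lemma resolution₀_freeMk (a₁ : U₁) (b₁ : U₂) (c₁ : U₃) (a₂ a₂' : U₁) (b₂ : U₂) (a₃ : U₁)
    (b₃ b₃' : U₂) (c₃ : U₃) :
    resolution₀ p q f g hf hg (freeMk a₁ b₁ c₁ a₂ a₂' b₂ a₃ b₃ b₃' c₃) =
      tot (R := normal p q f g hf hg) (a₁, f b₁ + c₁) (p a₂' + b₂, a₂ + q a₂')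
        (f b₃' + c₃, p a₃ + (b₃ + g b₃')) := by
  rw [resolution₀, freeHom_freeMk]
  apply total_ext <;> simp

lemma resolution₁_freeMk (a₁ : PUnit.{u + 1}) (b₁ : U₁) (c₁ : U₂) (a₂ a₂' : PUnit.{u + 1})
    (b₂ : U₁) (a₃ : PUnit.{u + 1}) (b₃ b₃' : U₁) (c₃ : U₂) :
    resolution₁ p q f g (freeMk a₁ b₁ c₁ a₂ a₂' b₂ a₃ b₃ b₃' c₃) =
      freeMk 0 (c₁ - p b₁) (-f c₁) (-q b₂) b₂ (-p b₂) (b₃ - q b₃') (-p b₃ - g c₃)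
        (c₃ - p b₃') (-f c₃) := by
  rw [resolution₁, freeHom_freeMk]
  apply total_ext <;> simp [freeMk, sub_eq_add_neg, add_comm]

lemma resolution₂_freeMk (a₁ b₁ : PUnit.{u + 1}) (c₁ : U₁) (a₂ a₂' b₂ a₃ b₃ b₃' : PUnit.{u + 1})
    (c₃ : U₁) :
    resolution₂ p q (freeMk a₁ b₁ c₁ a₂ a₂' b₂ a₃ b₃ b₃' c₃) =
      freeMk 0 c₁ (p c₁) 0 0 0 0 (q c₃) c₃ (p c₃) := by
  rw [resolution₂, freeHom_freeMk]
  apply total_ext <;> simp [freeMk]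

lemma resolution₂_injective : Function.Injective (resolution₂ p q) := by
  rw [← LinearMap.ker_eq_bot, LinearMap.ker_eq_bot']
  rintro ⟨⟨a₁, b₁, c₁⟩, ⟨a₂, a₂', b₂⟩, ⟨a₃, b₃, b₃', c₃⟩⟩ h
  have h' := (resolution₂_freeMk p q a₁ b₁ c₁ a₂ a₂' b₂ a₃ b₃ b₃' c₃).symm.trans h
  have h₁ : c₁ = 0 := congrArg (fun x => x.1.2.1) h'
  have h₃ : c₃ = 0 := congrArg (fun x => x.2.2.2.2.1) h'
  rw [h₁, h₃]
  rfl

lemma resolution₂_resolution₁_exact (hf : ∀ u, f (p u) = 0) (hg : ∀ u, g (p u) + p (q u) = 0) :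
    Function.Exact (resolution₂ p q) (resolution₁ p q f g) := by
  rintro ⟨⟨a₁, b₁, c₁⟩, ⟨a₂, a₂', b₂⟩, ⟨a₃, b₃, b₃', c₃⟩⟩
  have e := resolution₁_freeMk p q f g a₁ b₁ c₁ a₂ a₂' b₂ a₃ b₃ b₃' c₃
  constructor
  · intro h
    have h' := e.symm.trans h
    have h₁ : c₁ - p b₁ = 0 := congrArg (fun x => x.1.2.1) h'
    have h₂ : b₂ = 0 := congrArg (fun x => x.2.1.2.1) h'
    have h₃ : b₃ - q b₃' = 0 := congrArg (fun x => x.2.2.1) h'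
    have h₄ : c₃ - p b₃' = 0 := congrArg (fun x => x.2.2.2.2.1) h'
    rw [sub_eq_zero] at h₁ h₃ h₄
    subst h₁ h₂ h₃ h₄
    exact ⟨freeMk 0 0 b₁ 0 0 0 0 0 0 b₃', resolution₂_freeMk ..⟩
  · rintro ⟨⟨⟨x₁, y₁, z₁⟩, ⟨x₂, x₂', y₂⟩, ⟨x₃, y₃, y₃', z₃⟩⟩, h⟩
    have h' := (resolution₂_freeMk p q x₁ y₁ z₁ x₂ x₂' y₂ x₃ y₃ y₃' z₃).symm.trans h
    refine e.trans ?_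
    have h₁ : z₁ = b₁ := congrArg (fun x => x.1.2.1) h'
    have h₂ : p z₁ = c₁ := congrArg (fun x => x.1.2.2) h'
    have h₃ : 0 = b₂ := congrArg (fun x => x.2.1.2.2) h'
    have h₄ : q z₃ = b₃ := congrArg (fun x => x.2.2.2.1) h'
    have h₅ : z₃ = b₃' := congrArg (fun x => x.2.2.2.2.1) h'
    have h₆ : p z₃ = c₃ := congrArg (fun x => x.2.2.2.2.2) h'
    subst h₁ h₂ h₃ h₄ h₅ h₆
    have hgp := eq_neg_of_add_eq_zero_left (hg z₃)
    apply total_ext <;> simp [freeMk, hf, hgp]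

lemma resolution₁_resolution₀_exact :
    Function.Exact (resolution₁ p q f g) (resolution₀ p q f g hf hg) := by
  rintro ⟨⟨a₁, b₁, c₁⟩, ⟨a₂, a₂', b₂⟩, ⟨a₃, b₃, b₃', c₃⟩⟩
  have e := resolution₀_freeMk p q f g hf hg a₁ b₁ c₁ a₂ a₂' b₂ a₃ b₃ b₃' c₃
  constructor
  · intro h
    have h' := e.symm.trans h
    have h₁ : a₁ = 0 := congrArg (fun x => x.1.1) h'
    have h₂ : f b₁ + c₁ = 0 := congrArg (fun x => x.1.2) h'
    have h₃ : p a₂' + b₂ = 0 := congrArg (fun x => x.2.1.1) h'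
    have h₄ : a₂ + q a₂' = 0 := congrArg (fun x => x.2.1.2) h'
    have h₅ : f b₃' + c₃ = 0 := congrArg (fun x => x.2.2.1) h'
    have h₆ : p a₃ + (b₃ + g b₃') = 0 := congrArg (fun x => x.2.2.2) h'
    refine ⟨freeMk 0 0 b₁ 0 0 a₂' 0 a₃ 0 b₃', (resolution₁_freeMk ..).trans ?_⟩
    have h₂' := eq_neg_of_add_eq_zero_right h₂
    have h₃' := eq_neg_of_add_eq_zero_right h₃
    have h₄' := eq_neg_of_add_eq_zero_left h₄
    have h₅' := eq_neg_of_add_eq_zero_right h₅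
    have h₆' : b₃ = -p a₃ - g b₃' := by
      rw [eq_sub_iff_add_eq]; exact eq_neg_of_add_eq_zero_right h₆
    subst h₁ h₂' h₃' h₄' h₅' h₆'
    apply total_ext <;> simp [freeMk]
  · rintro ⟨⟨⟨x₁, y₁, z₁⟩, ⟨x₂, x₂', y₂⟩, ⟨x₃, y₃, y₃', z₃⟩⟩, h⟩
    have h' := (resolution₁_freeMk p q f g x₁ y₁ z₁ x₂ x₂' y₂ x₃ y₃ y₃' z₃).symm.trans h
    refine e.trans ?_
    have h₁ : 0 = a₁ := congrArg (fun x => x.1.1) h'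
    have h₂ : z₁ - p y₁ = b₁ := congrArg (fun x => x.1.2.1) h'
    have h₃ : -f z₁ = c₁ := congrArg (fun x => x.1.2.2) h'
    have h₄ : -q y₂ = a₂ := congrArg (fun x => x.2.1.1) h'
    have h₅ : y₂ = a₂' := congrArg (fun x => x.2.1.2.1) h'
    have h₆ : -p y₂ = b₂ := congrArg (fun x => x.2.1.2.2) h'
    have h₇ : y₃ - q y₃' = a₃ := congrArg (fun x => x.2.2.1) h'
    have h₈ : -p y₃ - g z₃ = b₃ := congrArg (fun x => x.2.2.2.1) h'
    have h₉ : z₃ - p y₃' = b₃' := congrArg (fun x => x.2.2.2.2.1) h'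
    have h₁₀ : -f z₃ = c₃ := congrArg (fun x => x.2.2.2.2.2) h'
    subst h₁ h₂ h₃ h₄ h₅ h₆ h₇ h₈ h₉ h₁₀
    have hgp := eq_neg_of_add_eq_zero_left (hg y₃')
    apply total_ext <;> simp [hf, hgp]
    abel

lemma resolution₀_surjective : Function.Surjective (resolution₀ p q f g hf hg) := by
  rintro ⟨⟨u₁, u₃⟩, ⟨u₂, u₁'⟩, ⟨u₃', u₂'⟩⟩
  refine ⟨freeMk u₁ 0 u₃ u₁' 0 u₂ 0 u₂' 0 u₃', (resolution₀_freeMk ..).trans ?_⟩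
  apply total_ext <;> simp [tot]

lemma normal_hasProjDimLE_two :
    HasProjDimLE (Alg K) 2 (ModuleCat.of (Alg K) (normal p q f g hf hg).Total) :=
  hasProjDimLE_two_of_exact (resolution₂ p q) (resolution₁ p q f g) (resolution₀ p q f g hf hg)
    (resolution₂_injective p q) (resolution₂_resolution₁_exact p q f g hf hg)
    (resolution₁_resolution₀_exact p q f g hf hg) (resolution₀_surjective p q f g hf hg)

/-- Projective dimension bounds are invariant under isomorphism. -/
lemma _root_.SquareRep.hasProjDimLE_succ_of_equiv {Λ : Type u} [Ring Λ] {n : ℕ}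
    {M N : Type u} [AddCommGroup M] [Module Λ M] [AddCommGroup N] [Module Λ N] (e : M ≃ₗ[Λ] N)
    (hM : HasProjDimLE Λ (n + 1) (ModuleCat.of Λ M)) :
    HasProjDimLE Λ (n + 1) (ModuleCat.of Λ N) := by
  obtain ⟨P, g, hP, hg, hN⟩ := hM
  refine ⟨P, e.toLinearMap ∘ₗ g, hP, e.surjective.comp hg, ?_⟩
  change HasProjDimLE Λ n (ModuleCat.of Λ (LinearMap.ker (e.toLinearMap ∘ₗ g)))
  rwa [LinearEquiv.ker_comp]

end Normal

lemma diff_smul_tot {R : QuiverRep K} (x : R.V₁) (y : R.V₂) (z : R.V₃) :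
    (diff : Alg K) • (tot x y z : R.Total) = tot (R.γ z) (R.α x) (R.σ y) := by
  apply total_ext <;> simp [diff, gen_coord]

lemma diffExact_iff {R : QuiverRep K} :
    DiffExact K R.Total ↔ (∀ x, R.α x = 0 → ∃ z, R.γ z = x) ∧ (∀ y, R.σ y = 0 → ∃ x, R.α x = y) ∧
      ∀ z, R.γ z = 0 → ∃ y, R.σ y = z := by
  constructor
  · intro h
    refine ⟨fun x hx => ?_, fun y hy => ?_, fun z hz => ?_⟩
    · obtain ⟨⟨x', y', z'⟩, h'⟩ :=
        h (tot x 0 0) (by rw [diff_smul_tot, hx, map_zero, map_zero]; rfl)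
      exact ⟨z', (congrArg (fun t => t.1) (h'.trans (diff_smul_tot ..))).symm⟩
    · obtain ⟨⟨x', y', z'⟩, h'⟩ :=
        h (tot 0 y 0) (by rw [diff_smul_tot, hy, map_zero, map_zero]; rfl)
      exact ⟨x', (congrArg (fun t => t.2.1) (h'.trans (diff_smul_tot ..))).symm⟩
    · obtain ⟨⟨x', y', z'⟩, h'⟩ :=
        h (tot 0 0 z) (by rw [diff_smul_tot, hz, map_zero, map_zero]; rfl)
      exact ⟨y', (congrArg (fun t => t.2.2) (h'.trans (diff_smul_tot ..))).symm⟩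
  · rintro ⟨hα, hσ, hγ⟩ ⟨x, y, z⟩ h
    have h' := (diff_smul_tot x y z).symm.trans h
    obtain ⟨z', rfl⟩ := hα x (congrArg (fun t => t.2.1) h')
    obtain ⟨x', rfl⟩ := hσ y (congrArg (fun t => t.2.2) h')
    obtain ⟨y', rfl⟩ := hγ z (congrArg (fun t => t.1) h')
    exact ⟨tot x' y' z', (diff_smul_tot x' y' z').symm⟩

lemma _root_.SquareRep.DiffExact.of_equiv {M N : Type*} [AddCommGroup M] [Module (Alg K) M]
    [AddCommGroup N] [Module (Alg K) N] (e : M ≃ₗ[Alg K] N) (h : DiffExact K M) :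
    DiffExact K N := fun n hn => by
  obtain ⟨m, hm⟩ := h (e.symm n) (by rw [← map_smul, hn, map_zero])
  exact ⟨e m, by rw [← map_smul, ← hm, e.apply_symm_apply]⟩

/-- A complement of the range of `g` together with a complement of the kernel of `g` make up the
target of `g`. -/
lemma coprod_subtype_bijective {V W : Type*} [AddCommGroup V] [AddCommGroup W] [Module K V]
    [Module K W] (g : W →ₗ[K] V) {U : Submodule K V} {T : Submodule K W}
    (hU : IsCompl (LinearMap.range g) U) (hT : IsCompl (LinearMap.ker g) T) :
    Function.Bijective (U.subtype.coprod (g ∘ₗ T.subtype)) := by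
  constructor
  · rw [← LinearMap.ker_eq_bot, LinearMap.ker_eq_bot']
    rintro ⟨u, t⟩ h
    replace h : (u : V) + g t = 0 := h
    have hu : (u : V) = 0 := Submodule.disjoint_def.1 hU.disjoint _
      ⟨-(t : W), by rw [map_neg, eq_neg_of_add_eq_zero_left h]⟩ u.2
    rw [hu, zero_add] at h
    have ht : (t : W) = 0 := Submodule.disjoint_def.1 hT.disjoint _ h t.2
    exact Prod.ext (Subtype.ext hu) (Subtype.ext ht)
  · intro v
    obtain ⟨_, ⟨w, rfl⟩, u, hu, rfl⟩ :=
      Submodule.mem_sup.1 (hU.sup_eq_top ▸ Submodule.mem_top (x := v))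
    obtain ⟨k, hk, t, ht, rfl⟩ :=
      Submodule.mem_sup.1 (hT.sup_eq_top ▸ Submodule.mem_top (x := w))
    refine ⟨(⟨u, hu⟩, ⟨t, ht⟩), ?_⟩
    change u + g t = g (k + t) + u
    rw [map_add, LinearMap.mem_ker.1 hk, zero_add, add_comm]

/-- A representation on which `diff` acts exactly has a normal form. -/
lemma exists_normal_equiv (R : QuiverRep K) (hR : DiffExact K R.Total) :
    ∃ (U₁ U₂ U₃ : Type u) (_ : AddCommGroup U₁) (_ : AddCommGroup U₂) (_ : AddCommGroup U₃)
      (_ : Module K U₁) (_ : Module K U₂) (_ : Module K U₃) (p : U₁ →ₗ[K] U₂) (q : U₁ →ₗ[K] U₁)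
      (f : U₂ →ₗ[K] U₃) (g : U₂ →ₗ[K] U₂) (hf : ∀ u, f (p u) = 0)
      (hg : ∀ u, g (p u) + p (q u) = 0),
      Nonempty ((normal p q f g hf hg).Total ≃ₗ[Alg K] R.Total) := by
  obtain ⟨hα, hσ, hγ⟩ := diffExact_iff.1 hR
  have kα : LinearMap.ker R.α = LinearMap.range R.γ :=
    le_antisymm hα (by rintro _ ⟨z, rfl⟩; exact R.αγ z)
  have kσ : LinearMap.ker R.σ = LinearMap.range R.α :=
    le_antisymm hσ (by rintro _ ⟨z, rfl⟩; exact R.σα z)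
  have kγ : LinearMap.ker R.γ = LinearMap.range R.σ :=
    le_antisymm hγ (by rintro _ ⟨z, rfl⟩; exact R.γσ z)
  obtain ⟨U₁, h₁⟩ := exists_isCompl (LinearMap.range R.γ)
  obtain ⟨U₂, h₂⟩ := exists_isCompl (LinearMap.range R.α)
  obtain ⟨U₃, h₃⟩ := exists_isCompl (LinearMap.range R.σ)
  have b₁ := coprod_subtype_bijective R.γ h₁ (kγ ▸ h₃)
  have b₂ := coprod_subtype_bijective R.α h₂ (kα ▸ h₁)
  have b₃ := coprod_subtype_bijective R.σ h₃ (kσ ▸ h₂)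
  let e₂ := LinearEquiv.ofBijective _ b₂
  let e₃ := LinearEquiv.ofBijective _ b₃
  let p : U₁ →ₗ[K] U₂ := LinearMap.fst K U₂ U₁ ∘ₗ e₂.symm.toLinearMap ∘ₗ R.β ∘ₗ U₁.subtype
  let q : U₁ →ₗ[K] U₁ := LinearMap.snd K U₂ U₁ ∘ₗ e₂.symm.toLinearMap ∘ₗ R.β ∘ₗ U₁.subtype
  let f : U₂ →ₗ[K] U₃ := LinearMap.fst K U₃ U₂ ∘ₗ e₃.symm.toLinearMap ∘ₗ R.ζ ∘ₗ U₂.subtype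
  let g : U₂ →ₗ[K] U₂ := LinearMap.snd K U₃ U₂ ∘ₗ e₃.symm.toLinearMap ∘ₗ R.ζ ∘ₗ U₂.subtype
  have hβ : ∀ u : U₁, (p u : R.V₂) + R.α (q u) = R.β u := fun u => e₂.apply_symm_apply (R.β u)
  have hζ : ∀ u : U₂, (f u : R.V₃) + R.σ (g u) = R.ζ u := fun u => e₃.apply_symm_apply (R.ζ u)
  have hζα : ∀ u : U₁, R.ζ (R.α u) = R.σ (p u) := fun u => by
    rw [← R.σβ, ← hβ, map_add, R.σα, add_zero]
  have key : ∀ u, (f (p u), g (p u) + p (q u)) = (0 : U₃ × U₂) := fun u => e₃.injective (by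
    rw [map_zero]
    change (f (p u) : R.V₃) + R.σ (g (p u) + p (q u)) = 0
    rw [map_add, ← hζα, ← add_assoc, hζ, ← map_add, hβ, R.ζβ])
  refine ⟨U₁, U₂, U₃, _, _, _, _, _, _, p, q, f, g, fun u => congrArg Prod.fst (key u),
    fun u => congrArg Prod.snd (key u), ⟨LinearEquiv.ofBijective
      (homMk (R := normal p q f g _ _) _ _ _ ?_ ?_ ?_ ?_ ?_) (b₁.prodMap (b₂.prodMap b₃))⟩⟩
  · rintro ⟨u, u'⟩
    simp
  · rintro ⟨u, u'⟩
    simp [← hβ]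
  · rintro ⟨u, u'⟩
    simp
  · rintro ⟨u, u'⟩
    simp [← hζ, hζα, add_assoc]
  · rintro ⟨u, u'⟩
    simp

end QuiverRep

section ProjDim

variable {K : Type u} [Field K]

lemma hasProjDimLE_two_of_diffExact (M : ModuleCat.{u} (Alg K)) (hM : DiffExact K M) :
    HasProjDimLE (Alg K) 2 M := by
  let _ : Module K M := Module.compHom M (algebraMap K (Alg K))
  have : IsScalarTower K (Alg K) M := IsScalarTower.of_algebraMap_smul fun _ _ => rfl
  let e := QuiverRep.ofModuleEquiv (K := K) M
  obtain ⟨U₁, U₂, U₃, _, _, _, _, _, _, p, q, f, g, hf, hg, ⟨e'⟩⟩ :=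
    QuiverRep.exists_normal_equiv _ (hM.of_equiv e.symm)
  exact hasProjDimLE_succ_of_equiv (e'.trans e)
    (QuiverRep.normal_hasProjDimLE_two p q f g hf hg)

lemma hasFinProjDim_iff (M : ModuleCat.{u} (Alg K)) : HasFinProjDim (Alg K) M ↔ DiffExact K M :=
  ⟨fun ⟨n, h⟩ => DiffExact.of_hasProjDimLE n M h, fun h => ⟨2, hasProjDimLE_two_of_diffExact M h⟩⟩

end ProjDim

section Examples

variable {K : Type u} [Field K]

/-- The representation with the pair of maps `id, x` at the arrows `α, β`. -/
abbrev endoRep {V : Type u} [AddCommGroup V] [Module K V] (x : V →ₗ[K] V) : QuiverRep K where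
  V₁ := V
  V₂ := V
  V₃ := PUnit.{u + 1}
  α := LinearMap.id
  β := x
  σ := 0
  ζ := 0
  γ := 0
  σα _ := rfl
  ζβ _ := rfl
  σβ _ := rfl
  γσ _ := rfl
  αγ _ := rfl
  βγ _ := map_zero x

lemma diffExact_endoRep {V : Type u} [AddCommGroup V] [Module K V] (x : V →ₗ[K] V) :
    DiffExact K (endoRep x).Total :=
  QuiverRep.diffExact_iff.2 ⟨fun v hv => ⟨0, (show v = 0 from hv).symm⟩, fun v _ => ⟨v, rfl⟩,
    fun _ _ => ⟨0, rfl⟩⟩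

variable (K) in
/-- The simple representation at the second vertex. -/
abbrev simpleRep : QuiverRep K where
  V₁ := PUnit.{u + 1}
  V₂ := K
  V₃ := PUnit.{u + 1}
  α := 0
  β := 0
  σ := 0
  ζ := 0
  γ := 0
  σα _ := rfl
  ζβ _ := rfl
  σβ _ := rfl
  γσ _ := rfl
  αγ _ := rfl
  βγ _ := rfl

variable (K) in
/-- The generator of the simple module at the second vertex. -/
def simpleGen : (simpleRep K).Total := QuiverRep.tot (R := simpleRep K) 0 1 0

instance : IsSimpleModule (Alg K) (simpleRep K).Total := by
  have : Nontrivial (simpleRep K).Total :=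
    ⟨simpleGen K, 0, fun h => one_ne_zero (α := K) (congrArg (fun t => t.2.1) h)⟩
  rw [isSimpleModule_iff_toSpanSingleton_surjective]
  refine ⟨this, ?_⟩
  rintro ⟨⟨⟩, a, ⟨⟩⟩ ha ⟨⟨⟩, b, ⟨⟩⟩
  have ha' : a ≠ 0 := fun h => ha (by rw [h]; rfl)
  refine ⟨((b * a⁻¹) • gen 1 : Alg K), ?_⟩
  change ((b * a⁻¹) • gen 1 : Alg K) • QuiverRep.tot (R := simpleRep K) 0 a 0 =
    QuiverRep.tot (R := simpleRep K) 0 b 0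
  apply QuiverRep.total_ext <;> simp [gen_coord, ha']

/-- The map from the simple module into the module of an endomorphism given by a vector. -/
def simpleHom {V : Type u} [AddCommGroup V] [Module K V] (x : V →ₗ[K] V) (v : V) :
    (simpleRep K).Total →ₗ[Alg K] (endoRep x).Total :=
  QuiverRep.homMk (R := simpleRep K) (S := endoRep x) 0 (LinearMap.toSpanSingleton K V v) 0
    (fun _ => by simp) (fun _ => by simp) (fun _ => rfl) (fun _ => rfl) (fun _ => rfl)

lemma simpleHom_simpleGen {V : Type u} [AddCommGroup V] [Module K V] (x : V →ₗ[K] V) (v : V) :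
    simpleHom x v (simpleGen K) = QuiverRep.tot (R := endoRep x) 0 v 0 := by
  apply QuiverRep.total_ext <;> simp [simpleGen, simpleHom, QuiverRep.homMk]

/-- In a module on which `diff` acts exactly, every element of the second vertex space killed by
`σ` and `ζ` starts a sequence of such elements, each of them being obtained from its predecessor by
inverting `α` and applying `β`. -/
lemma exists_chain {A : Type*} [AddCommGroup A] [Module (Alg K) A] (hA : DiffExact K A) (v₀ : A)
    (h₁ : (gen 1 : Alg K) • v₀ = v₀) (h₅ : (gen 5 : Alg K) • v₀ = 0)
    (h₆ : (gen 6 : Alg K) • v₀ = 0) :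
    ∃ v w : ℕ → A, v 0 = v₀ ∧ (∀ n, (gen 3 : Alg K) • w n = v n) ∧
      ∀ n, v (n + 1) = (gen 4 : Alg K) • w n := by
  have mul : (gen 3 * gen 1 : Alg K) = 0 ∧ (gen 7 * gen 1 : Alg K) = 0 ∧
      (gen 1 * diff : Alg K) = gen 3 ∧ (gen 1 * gen 4 : Alg K) = gen 4 ∧
      (gen 5 * gen 4 : Alg K) = gen 6 * gen 3 ∧ (gen 6 * gen 4 : Alg K) = 0 := by
    refine ⟨?_, ?_, ?_, ?_, ?_, ?_⟩ <;> apply ext_coord <;> simp [diff, gen_coord]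
  obtain ⟨e31, e71, e1d, e14, e54, e64⟩ := mul
  let T := {v : A // (gen 1 : Alg K) • v = v ∧ (gen 5 : Alg K) • v = 0 ∧ (gen 6 : Alg K) • v = 0}
  have step : ∀ v : T, ∃ w : A, (gen 3 : Alg K) • w = v := by
    rintro ⟨v, h₁, h₅, h₆⟩
    obtain ⟨n, hn⟩ := hA v (by
      rw [diff, add_smul, add_smul, h₅, ← h₁, smul_smul, smul_smul, e31, e71, zero_smul,
        add_zero, add_zero])
    exact ⟨n, by rw [← e1d, mul_smul, ← hn]; exact h₁⟩
  choose w hw using step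
  let next : T → T := fun v => ⟨(gen 4 : Alg K) • w v, by rw [smul_smul, e14],
        by rw [smul_smul, e54, mul_smul, hw, v.2.2.2], by rw [smul_smul, e64, zero_smul]⟩
  let s : ℕ → T := fun n => next^[n] ⟨v₀, h₁, h₅, h₆⟩
  refine ⟨fun n => s n, fun n => w (s n), rfl, fun n => hw _, fun n => ?_⟩
  change ((next^[n + 1] ⟨v₀, h₁, h₅, h₆⟩ : T) : A) = _
  rw [Function.iterate_succ_apply']

/-- The action of the arrows on the module of an endomorphism transports chains as in
`exists_chain` to orbits of the endomorphism. -/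
lemma map_chain {A V : Type u} [AddCommGroup A] [Module (Alg K) A] [AddCommGroup V] [Module K V]
    (x : V →ₗ[K] V) (h : A →ₗ[Alg K] (endoRep x).Total) {v w : ℕ → A}
    (h₃ : ∀ n, (gen 3 : Alg K) • w n = v n) (h₄ : ∀ n, v (n + 1) = (gen 4 : Alg K) • w n) (n : ℕ) :
    (h (v n)).2.1 = (x ^ n) (h (v 0)).2.1 := by
  induction n with
  | zero => simp
  | succ n ih =>
    rw [pow_succ', Module.End.mul_apply, ← ih, h₄, ← h₃ n, map_smul, map_smul]
    simp [gen_coord]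

lemma not_isLeftApprox_simpleRep (A : ModuleCat.{u} (Alg K))
    (f : (simpleRep K).Total →ₗ[Alg K] A) :
    ¬ IsLeftApprox (Alg K) (ModuleCat.of (Alg K) (simpleRep K).Total) A f := by
  rintro ⟨hfin, hA, hf⟩
  have hgen : (gen 1 : Alg K) • simpleGen K = simpleGen K ∧ (gen 5 : Alg K) • simpleGen K = 0 ∧
      (gen 6 : Alg K) • simpleGen K = 0 := by
    refine ⟨?_, ?_, ?_⟩ <;> apply QuiverRep.total_ext <;> simp [simpleGen, gen_coord]
  obtain ⟨v, w, h₀, h₃, h₄⟩ := exists_chain ((hasFinProjDim_iff A).1 hA) (f (simpleGen K))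
    (by rw [← map_smul, hgen.1]) (by rw [← map_smul, hgen.2.1, map_zero])
    (by rw [← map_smul, hgen.2.2, map_zero])
  let _ : Module K A := Module.compHom A (algebraMap K (Alg K))
  have : IsScalarTower K (Alg K) A := IsScalarTower.of_algebraMap_smul fun _ _ => rfl
  have : Module.Finite K A := Module.Finite.trans (Alg K) A
  let d := Module.finrank K A
  let x : (ZMod (d + 1) → K) →ₗ[K] (ZMod (d + 1) → K) :=
    LinearMap.funLeft K K fun i => i - 1
  have hx : ∀ n : ℕ, (x ^ n) (Pi.single 0 1) = Pi.single (n : ZMod (d + 1)) 1 := fun n => by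
    induction n with
    | zero => simp
    | succ n ih =>
      rw [pow_succ', Module.End.mul_apply, ih]
      funext i
      simp [x, Pi.single_apply, LinearMap.funLeft_apply, sub_eq_iff_eq_add]
  have hfinB : Module.Finite (Alg K) (endoRep x).Total := by
    have : Module.Finite K (endoRep x).Total :=
      inferInstanceAs (Module.Finite K
        ((ZMod (d + 1) → K) × (ZMod (d + 1) → K) × PUnit.{u + 1}))
    exact Module.Finite.of_restrictScalars_finite K _ _
  obtain ⟨h, hh⟩ := hf (ModuleCat.of _ (endoRep x).Total) hfinB
    ((hasFinProjDim_iff _).2 (diffExact_endoRep x)) (simpleHom x (Pi.single 0 1))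
  have hv : ∀ n, (h (v n)).2.1 = Pi.single (M := fun _ => K) (n : ZMod (d + 1)) 1 := fun n => by
    rw [← hx, map_chain x h h₃ h₄, h₀]
    have : h (f (simpleGen K)) = _ :=
      (LinearMap.congr_fun hh (simpleGen K)).trans (simpleHom_simpleGen x _)
    rw [this]
    rfl
  let φ : A →ₗ[K] (ZMod (d + 1) → K) :=
    { toFun := fun a => (h a).2.1
      map_add' := fun a b => by rw [map_add]; rfl
      map_smul' := fun k a => by
        rw [LinearMap.map_smul_of_tower]; rfl }
  have hli : LinearIndependent K fun i : ZMod (d + 1) => v i.val := by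
    refine LinearIndependent.of_comp φ ?_
    have : φ ∘ (fun i : ZMod (d + 1) => v i.val) =
        Pi.basisFun K (ZMod (d + 1)) := by
      funext i
      exact (hv i.val).trans (by simp)
    rw [this]
    exact (Pi.basisFun K _).linearIndependent
  have := hli.fintype_card_le_finrank
  simp [d] at this

/-- The module of the zero endomorphism of the ground field has projective dimension two. -/
lemma not_hasProjDimLE_one_endoRep :
    ¬ HasProjDimLE (Alg K) 1 (ModuleCat.of (Alg K) (endoRep (0 : K →ₗ[K] K)).Total) ∧
      ¬ HasProjDimLE (Alg K) 0 (ModuleCat.of (Alg K) (endoRep (0 : K →ₗ[K] K)).Total) := by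
  let m : (endoRep (0 : K →ₗ[K] K)).Total := QuiverRep.tot (R := endoRep 0) 1 0 0
  have h₁ : (gen 0 : Alg K) • m = m := by
    apply QuiverRep.total_ext <;> simp [m, gen_coord]
  have h₂ : (gen 4 : Alg K) • m = 0 := by
    apply QuiverRep.total_ext <;> simp [m, gen_coord]
  have h₃ : ¬ ∃ n, m = (gen 7 : Alg K) • n := by
    rintro ⟨n, hn⟩
    have : (1 : K) = _ := congrArg (fun t => t.1) hn
    simp [gen_coord] at this
  refine ⟨fun h => h₃ (exists_gamma_of_hasProjDimLE_one _ h m h₁ h₂), fun h => h₃ ?_⟩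
  have : Module.Projective (Alg K) (endoRep (0 : K →ₗ[K] K)).Total := h
  exact exists_gamma_of_projective m h₁ h₂

lemma finDimBig_eq_two : finDimBig (Alg K) = 2 := by
  refine le_antisymm (iSup₂_le fun M hM => sInf_le
    ⟨2, rfl, hasProjDimLE_two_of_diffExact M ((hasFinProjDim_iff M).1 hM)⟩) ?_
  refine le_trans (le_sInf ?_) (le_iSup₂ (f := fun (M : ModuleCat.{u} (Alg K))
    (_ : HasFinProjDim (Alg K) M) => projDim (Alg K) M)
    (ModuleCat.of (Alg K) (endoRep (0 : K →ₗ[K] K)).Total)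
    ((hasFinProjDim_iff _).2 (diffExact_endoRep 0)))
  rintro _ ⟨n, rfl, hn⟩
  match n, hn with
  | 0, hn => exact absurd hn not_hasProjDimLE_one_endoRep.2
  | 1, hn => exact absurd hn not_hasProjDimLE_one_endoRep.1
  | n + 2, _ => exact_mod_cast Nat.le_add_left 2 n

end Examples

end SquareRep

/-- For every field `K` there exists a finite-dimensional `K`-algebra `Λ`
with `l.Findim Λ = 2` together with a simple left `Λ`-module `S` admitting no left
`P^∞(Λ-mod)`-approximation; in particular `P^∞(Λ-mod)` is not covariantly finite in
`Λ-mod`. -/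
theorem exists_FinDim_two_not_covariantlyFinite (K : Type u) [Field K] :
    ∃ Λ : FDAlg K, finDimBig Λ.carrier = 2 ∧
      (∃ S : ModuleCat.{u} Λ.carrier, IsSimpleModule Λ.carrier S ∧
        ¬ ∃ (A : ModuleCat.{u} Λ.carrier) (f : S →ₗ[Λ.carrier] A),
          IsLeftApprox Λ.carrier S A f) ∧
      ¬ CovariantlyFinite Λ.carrier := by
  let S : ModuleCat.{u} (SquareRep.Alg K) :=
    ModuleCat.of (SquareRep.Alg K) (SquareRep.simpleRep K).Total
  have hS : IsSimpleModule (SquareRep.Alg K) S :=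
    inferInstanceAs (IsSimpleModule (SquareRep.Alg K) (SquareRep.simpleRep K).Total)
  exact ⟨⟨SquareRep.Alg K⟩, SquareRep.finDimBig_eq_two,
    ⟨S, hS, fun ⟨A, f, hf⟩ => SquareRep.not_isLeftApprox_simpleRep A f hf⟩, fun h => by
      obtain ⟨A, f, hf⟩ := h S inferInstance
      exact SquareRep.not_isLeftApprox_simpleRep A f hf⟩
end

section
/- For every field K there exists a finite-dimensional associative unital K-algebra Λ with l.Findim Λ = 1 such that P^∞(Λ-mod) is covariantly finite in Λ-mod but P^∞(Λ-mod) is not contravariantly finite in Λ-mod. In particular, contravariant finiteness of P^∞(Λ-mod) is strictly stronger than covariant finiteness of P^∞(Λ-mod). -/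
universe u

/-- The algebra of the quiver with two vertices `1`, `2`, arrows `α, β : 1 → 2` and `γ : 2 → 1`,
modulo the relations `αγ = βγ = γα = 0`, in coordinates with respect to the basis
`e₁, e₂, α, β, γ, γβ` of paths. -/
@[ext]
structure QuiverAlg (K : Type u) : Type u where
  /-- the coefficient of `e₁` -/
  c₁ : K
  /-- the coefficient of `e₂` -/
  c₂ : K
  /-- the coefficient of `α` -/
  ca : K
  /-- the coefficient of `β` -/
  cb : K
  /-- the coefficient of `γ` -/
  cg : K
  /-- the coefficient of `γβ` -/
  cd : K

namespace QuiverAlg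

variable {K : Type u} [Field K]

instance : Zero (QuiverAlg K) := ⟨⟨0, 0, 0, 0, 0, 0⟩⟩
instance : One (QuiverAlg K) := ⟨⟨1, 1, 0, 0, 0, 0⟩⟩
instance : Add (QuiverAlg K) := ⟨fun a b =>
  ⟨a.c₁ + b.c₁, a.c₂ + b.c₂, a.ca + b.ca, a.cb + b.cb, a.cg + b.cg, a.cd + b.cd⟩⟩
instance : Neg (QuiverAlg K) := ⟨fun a => ⟨-a.c₁, -a.c₂, -a.ca, -a.cb, -a.cg, -a.cd⟩⟩
instance : Mul (QuiverAlg K) := ⟨fun a b =>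
  ⟨a.c₁ * b.c₁, a.c₂ * b.c₂, a.c₂ * b.ca + a.ca * b.c₁, a.c₂ * b.cb + a.cb * b.c₁,
    a.c₁ * b.cg + a.cg * b.c₂, a.c₁ * b.cd + a.cd * b.c₁ + a.cg * b.cb⟩⟩
instance : SMul K (QuiverAlg K) := ⟨fun r a =>
  ⟨r * a.c₁, r * a.c₂, r * a.ca, r * a.cb, r * a.cg, r * a.cd⟩⟩

lemma zero_def : (0 : QuiverAlg K) = ⟨0, 0, 0, 0, 0, 0⟩ := rfl
lemma one_def : (1 : QuiverAlg K) = ⟨1, 1, 0, 0, 0, 0⟩ := rfl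
lemma add_def (a b : QuiverAlg K) : a + b =
  ⟨a.c₁ + b.c₁, a.c₂ + b.c₂, a.ca + b.ca, a.cb + b.cb, a.cg + b.cg, a.cd + b.cd⟩ := rfl
lemma neg_def (a : QuiverAlg K) : -a = ⟨-a.c₁, -a.c₂, -a.ca, -a.cb, -a.cg, -a.cd⟩ := rfl
lemma mul_def (a b : QuiverAlg K) : a * b =
  ⟨a.c₁ * b.c₁, a.c₂ * b.c₂, a.c₂ * b.ca + a.ca * b.c₁, a.c₂ * b.cb + a.cb * b.c₁,
    a.c₁ * b.cg + a.cg * b.c₂, a.c₁ * b.cd + a.cd * b.c₁ + a.cg * b.cb⟩ := rfl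
lemma smul_def (r : K) (a : QuiverAlg K) : r • a =
  ⟨r * a.c₁, r * a.c₂, r * a.ca, r * a.cb, r * a.cg, r * a.cd⟩ := rfl

instance : Ring (QuiverAlg K) where
  add_assoc a b c := by ext <;> simp only [add_def] <;> ring
  zero_add a := by ext <;> simp [add_def, zero_def]
  add_zero a := by ext <;> simp [add_def, zero_def]
  add_comm a b := by ext <;> simp only [add_def] <;> ring
  neg_add_cancel a := by ext <;> simp [add_def, neg_def, zero_def]
  nsmul := nsmulRec
  zsmul := zsmulRec
  mul_assoc a b c := by ext <;> simp only [mul_def] <;> ring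
  one_mul a := by ext <;> simp [mul_def, one_def]
  mul_one a := by ext <;> simp [mul_def, one_def]
  left_distrib a b c := by ext <;> simp only [add_def, mul_def] <;> ring
  right_distrib a b c := by ext <;> simp only [add_def, mul_def] <;> ring
  zero_mul a := by ext <;> simp [mul_def, zero_def]
  mul_zero a := by ext <;> simp [mul_def, zero_def]

instance : Module K (QuiverAlg K) where
  one_smul a := by ext <;> simp [smul_def]
  mul_smul r s a := by ext <;> simp only [smul_def] <;> ring
  smul_zero r := by ext <;> simp [smul_def, zero_def]
  smul_add r a b := by ext <;> simp only [smul_def, add_def] <;> ring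
  add_smul r s a := by ext <;> simp only [smul_def, add_def] <;> ring
  zero_smul a := by ext <;> simp [smul_def, zero_def]

instance : Algebra K (QuiverAlg K) :=
  Algebra.ofModule
    (fun r a b => by ext <;> simp only [smul_def, mul_def] <;> ring)
    (fun r a b => by ext <;> simp only [smul_def, mul_def] <;> ring)

instance : FiniteDimensional K (QuiverAlg K) :=
  Module.Finite.of_injective
    ({ toFun := fun a => (a.c₁, a.c₂, a.ca, a.cb, a.cg, a.cd)
       map_add' := fun _ _ => rfl
       map_smul' := fun _ _ => rfl } : QuiverAlg K →ₗ[K] K × K × K × K × K × K)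
    fun a b h => by
      simp only [LinearMap.coe_mk, AddHom.coe_mk, Prod.mk.injEq] at h
      ext <;> simp [h]

/-- The idempotent at the vertex `1`. -/
def e₁ : QuiverAlg K := ⟨1, 0, 0, 0, 0, 0⟩
/-- The idempotent at the vertex `2`. -/
def e₂ : QuiverAlg K := ⟨0, 1, 0, 0, 0, 0⟩
/-- The arrow `α : 1 → 2`. -/
def α : QuiverAlg K := ⟨0, 0, 1, 0, 0, 0⟩
/-- The arrow `β : 1 → 2`. -/
def β : QuiverAlg K := ⟨0, 0, 0, 1, 0, 0⟩
/-- The arrow `γ : 2 → 1`. -/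
def γ : QuiverAlg K := ⟨0, 0, 0, 0, 1, 0⟩
/-- The square-zero element `α + γ`. -/
def ρ : QuiverAlg K := ⟨0, 0, 1, 0, 1, 0⟩

lemma e₁_add_e₂ : (e₁ + e₂ : QuiverAlg K) = 1 := by
  ext <;> simp [e₁, e₂, add_def, one_def]

section Action

variable {M : Type*} [AddCommGroup M] [Module (QuiverAlg K) M] (m : M)

lemma e₁_add_e₂_smul : (e₁ : QuiverAlg K) • m + (e₂ : QuiverAlg K) • m = m := by
  rw [← add_smul, e₁_add_e₂, one_smul]

lemma ρ_smul : (ρ : QuiverAlg K) • m = (α : QuiverAlg K) • m + (γ : QuiverAlg K) • m := by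
  rw [← add_smul]; congr 1; ext <;> simp [ρ, α, γ, add_def]

@[simp] lemma e₁_e₁_smul :
    (e₁ : QuiverAlg K) • (e₁ : QuiverAlg K) • m = (e₁ : QuiverAlg K) • m := by
  rw [← mul_smul]; congr 1; ext <;> simp [e₁, mul_def]
@[simp] lemma e₁_e₂_smul : (e₁ : QuiverAlg K) • (e₂ : QuiverAlg K) • m = 0 := by
  rw [← mul_smul, ← zero_smul (QuiverAlg K) m]; congr 1; ext <;> simp [e₁, e₂, mul_def, zero_def]
@[simp] lemma e₁_α_smul : (e₁ : QuiverAlg K) • (α : QuiverAlg K) • m = 0 := by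
  rw [← mul_smul, ← zero_smul (QuiverAlg K) m]; congr 1; ext <;> simp [e₁, α, mul_def, zero_def]
@[simp] lemma e₁_β_smul : (e₁ : QuiverAlg K) • (β : QuiverAlg K) • m = 0 := by
  rw [← mul_smul, ← zero_smul (QuiverAlg K) m]; congr 1; ext <;> simp [e₁, β, mul_def, zero_def]
@[simp] lemma e₁_γ_smul : (e₁ : QuiverAlg K) • (γ : QuiverAlg K) • m = (γ : QuiverAlg K) • m := by
  rw [← mul_smul]; congr 1; ext <;> simp [e₁, γ, mul_def]
@[simp] lemma e₂_e₁_smul : (e₂ : QuiverAlg K) • (e₁ : QuiverAlg K) • m = 0 := by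
  rw [← mul_smul, ← zero_smul (QuiverAlg K) m]; congr 1; ext <;> simp [e₂, e₁, mul_def, zero_def]
@[simp] lemma e₂_e₂_smul :
    (e₂ : QuiverAlg K) • (e₂ : QuiverAlg K) • m = (e₂ : QuiverAlg K) • m := by
  rw [← mul_smul]; congr 1; ext <;> simp [e₂, mul_def]
@[simp] lemma e₂_α_smul : (e₂ : QuiverAlg K) • (α : QuiverAlg K) • m = (α : QuiverAlg K) • m := by
  rw [← mul_smul]; congr 1; ext <;> simp [e₂, α, mul_def]
@[simp] lemma e₂_β_smul : (e₂ : QuiverAlg K) • (β : QuiverAlg K) • m = (β : QuiverAlg K) • m := by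
  rw [← mul_smul]; congr 1; ext <;> simp [e₂, β, mul_def]
@[simp] lemma e₂_γ_smul : (e₂ : QuiverAlg K) • (γ : QuiverAlg K) • m = 0 := by
  rw [← mul_smul, ← zero_smul (QuiverAlg K) m]; congr 1; ext <;> simp [e₂, γ, mul_def, zero_def]
@[simp] lemma α_e₁_smul : (α : QuiverAlg K) • (e₁ : QuiverAlg K) • m = (α : QuiverAlg K) • m := by
  rw [← mul_smul]; congr 1; ext <;> simp [α, e₁, mul_def]
@[simp] lemma α_e₂_smul : (α : QuiverAlg K) • (e₂ : QuiverAlg K) • m = 0 := by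
  rw [← mul_smul, ← zero_smul (QuiverAlg K) m]; congr 1; ext <;> simp [α, e₂, mul_def, zero_def]
@[simp] lemma α_α_smul : (α : QuiverAlg K) • (α : QuiverAlg K) • m = 0 := by
  rw [← mul_smul, ← zero_smul (QuiverAlg K) m]; congr 1; ext <;> simp [α, mul_def, zero_def]
@[simp] lemma α_β_smul : (α : QuiverAlg K) • (β : QuiverAlg K) • m = 0 := by
  rw [← mul_smul, ← zero_smul (QuiverAlg K) m]; congr 1; ext <;> simp [α, β, mul_def, zero_def]
@[simp] lemma α_γ_smul : (α : QuiverAlg K) • (γ : QuiverAlg K) • m = 0 := by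
  rw [← mul_smul, ← zero_smul (QuiverAlg K) m]; congr 1; ext <;> simp [α, γ, mul_def, zero_def]
@[simp] lemma β_e₁_smul : (β : QuiverAlg K) • (e₁ : QuiverAlg K) • m = (β : QuiverAlg K) • m := by
  rw [← mul_smul]; congr 1; ext <;> simp [β, e₁, mul_def]
@[simp] lemma β_e₂_smul : (β : QuiverAlg K) • (e₂ : QuiverAlg K) • m = 0 := by
  rw [← mul_smul, ← zero_smul (QuiverAlg K) m]; congr 1; ext <;> simp [β, e₂, mul_def, zero_def]
@[simp] lemma β_α_smul : (β : QuiverAlg K) • (α : QuiverAlg K) • m = 0 := by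
  rw [← mul_smul, ← zero_smul (QuiverAlg K) m]; congr 1; ext <;> simp [β, α, mul_def, zero_def]
@[simp] lemma β_β_smul : (β : QuiverAlg K) • (β : QuiverAlg K) • m = 0 := by
  rw [← mul_smul, ← zero_smul (QuiverAlg K) m]; congr 1; ext <;> simp [β, mul_def, zero_def]
@[simp] lemma β_γ_smul : (β : QuiverAlg K) • (γ : QuiverAlg K) • m = 0 := by
  rw [← mul_smul, ← zero_smul (QuiverAlg K) m]; congr 1; ext <;> simp [β, γ, mul_def, zero_def]
@[simp] lemma γ_e₁_smul : (γ : QuiverAlg K) • (e₁ : QuiverAlg K) • m = 0 := by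
  rw [← mul_smul, ← zero_smul (QuiverAlg K) m]; congr 1; ext <;> simp [γ, e₁, mul_def, zero_def]
@[simp] lemma γ_e₂_smul : (γ : QuiverAlg K) • (e₂ : QuiverAlg K) • m = (γ : QuiverAlg K) • m := by
  rw [← mul_smul]; congr 1; ext <;> simp [γ, e₂, mul_def]
@[simp] lemma γ_α_smul : (γ : QuiverAlg K) • (α : QuiverAlg K) • m = 0 := by
  rw [← mul_smul, ← zero_smul (QuiverAlg K) m]; congr 1; ext <;> simp [γ, α, mul_def, zero_def]
@[simp] lemma γ_γ_smul : (γ : QuiverAlg K) • (γ : QuiverAlg K) • m = 0 := by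
  rw [← mul_smul, ← zero_smul (QuiverAlg K) m]; congr 1; ext <;> simp [γ, mul_def, zero_def]

lemma smul_eq [Module K M] [IsScalarTower K (QuiverAlg K) M] (a : QuiverAlg K) :
    a • m = a.c₁ • (e₁ : QuiverAlg K) • m + a.c₂ • (e₂ : QuiverAlg K) • m
      + a.ca • (α : QuiverAlg K) • m + a.cb • (β : QuiverAlg K) • m
      + a.cg • (γ : QuiverAlg K) • m + a.cd • (γ : QuiverAlg K) • (β : QuiverAlg K) • m := by
  rw [← mul_smul γ β]
  simp only [← smul_assoc, ← add_smul]
  congr 1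
  ext <;> simp [e₁, e₂, α, β, γ, mul_def, smul_def, add_def]

end Action

/-- A representation of the quiver of `QuiverAlg K` satisfying the relations, on a single vector
space `V` which is the direct sum of the images of the operators `e₁` and `e₂`. -/
structure Rep (K : Type u) [Field K] (V : Type u) [AddCommGroup V] [Module K V] where
  /-- the projection to the vertex `1` -/
  e₁ : Module.End K V
  /-- the projection to the vertex `2` -/
  e₂ : Module.End K V
  /-- the action of `α` -/
  α : Module.End K V
  /-- the action of `β` -/
  β : Module.End K V
  /-- the action of `γ` -/
  γ : Module.End K V
  add_eq_one : e₁ + e₂ = 1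
  e₁_e₁ : e₁ * e₁ = e₁
  e₂_α : e₂ * α = α
  α_e₁ : α * e₁ = α
  e₂_β : e₂ * β = β
  β_e₁ : β * e₁ = β
  e₁_γ : e₁ * γ = γ
  γ_e₂ : γ * e₂ = γ
  α_γ : α * γ = 0
  β_γ : β * γ = 0
  γ_α : γ * α = 0

namespace Rep

variable {V : Type u} [AddCommGroup V] [Module K V] (D : Rep K V)

lemma e₂_eq : D.e₂ = 1 - D.e₁ := eq_sub_of_add_eq' D.add_eq_one
lemma e₁_e₂ : D.e₁ * D.e₂ = 0 := by rw [e₂_eq, mul_sub, D.e₁_e₁, mul_one, sub_self]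
lemma e₂_e₁ : D.e₂ * D.e₁ = 0 := by rw [e₂_eq, sub_mul, D.e₁_e₁, one_mul, sub_self]
lemma e₂_e₂ : D.e₂ * D.e₂ = D.e₂ := by
  nth_rw 2 [e₂_eq]; rw [mul_sub, D.e₂_e₁, mul_one, sub_zero]
lemma e₁_α : D.e₁ * D.α = 0 := by rw [← D.e₂_α, ← mul_assoc, D.e₁_e₂, zero_mul]
lemma e₁_β : D.e₁ * D.β = 0 := by rw [← D.e₂_β, ← mul_assoc, D.e₁_e₂, zero_mul]
lemma e₂_γ : D.e₂ * D.γ = 0 := by rw [← D.e₁_γ, ← mul_assoc, D.e₂_e₁, zero_mul]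
lemma α_e₂ : D.α * D.e₂ = 0 := by rw [← D.α_e₁, mul_assoc, D.e₁_e₂, mul_zero]
lemma β_e₂ : D.β * D.e₂ = 0 := by rw [← D.β_e₁, mul_assoc, D.e₁_e₂, mul_zero]
lemma γ_e₁ : D.γ * D.e₁ = 0 := by rw [← D.γ_e₂, mul_assoc, D.e₂_e₁, mul_zero]
lemma α_α : D.α * D.α = 0 := by nth_rw 1 [← D.α_e₁]; rw [mul_assoc, D.e₁_α, mul_zero]
lemma α_β : D.α * D.β = 0 := by rw [← D.α_e₁, mul_assoc, D.e₁_β, mul_zero]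
lemma β_α : D.β * D.α = 0 := by rw [← D.β_e₁, mul_assoc, D.e₁_α, mul_zero]
lemma β_β : D.β * D.β = 0 := by nth_rw 1 [← D.β_e₁]; rw [mul_assoc, D.e₁_β, mul_zero]
lemma γ_γ : D.γ * D.γ = 0 := by nth_rw 1 [← D.γ_e₂]; rw [mul_assoc, D.e₂_γ, mul_zero]

/-- The action of `QuiverAlg K` on a representation. -/
def toEnd : QuiverAlg K →+* Module.End K V where
  toFun a := a.c₁ • D.e₁ + a.c₂ • D.e₂ + a.ca • D.α + a.cb • D.β + a.cg • D.γ
    + a.cd • (D.γ * D.β)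
  map_one' := by simp [one_def, D.add_eq_one]
  map_zero' := by simp [zero_def]
  map_add' a b := by simp only [add_def, add_smul]; abel
  map_mul' a b := by
    have h1 := D.e₁_e₁; have h2 := D.e₂_α; have h3 := D.α_e₁; have h4 := D.e₂_β
    have h5 := D.β_e₁; have h6 := D.e₁_γ; have h7 := D.γ_e₂; have h8 := D.α_γ
    have h9 := D.β_γ; have h10 := D.γ_α
    have l (x y z : Module.End K V) (h : x * y = z) (w : Module.End K V) :
      x * (y * w) = z * w := by rw [← mul_assoc, h]
    simp only [mul_def, add_mul, mul_add, smul_mul_smul_comm, mul_assoc, h1, h2, h3, h4, h5, h6,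
      h7, h8, h9, h10, D.e₁_e₂, D.e₂_e₁, D.e₂_e₂, D.e₁_α, D.e₁_β, D.e₂_γ, D.α_e₂, D.β_e₂, D.γ_e₁,
      D.α_α, D.α_β, D.β_α, D.β_β, D.γ_γ, l _ _ _ h6, l _ _ _ D.e₂_γ, l _ _ _ h8, l _ _ _ h9,
      l _ _ _ D.γ_γ, zero_mul, mul_zero, smul_zero, add_zero, zero_add, add_smul]
    abel

/-- The underlying space of a representation, viewed as a `QuiverAlg K`-module. -/
def Space (_ : Rep K V) : Type u := V

instance : AddCommGroup D.Space := inferInstanceAs (AddCommGroup V)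
instance : Module K D.Space := inferInstanceAs (Module K V)
instance : Module (QuiverAlg K) D.Space := Module.compHom V D.toEnd
instance [FiniteDimensional K V] : FiniteDimensional K D.Space :=
  inferInstanceAs (FiniteDimensional K V)

lemma smul_apply (a : QuiverAlg K) (v : D.Space) : a • v = D.toEnd a v := rfl

instance : IsScalarTower K (QuiverAlg K) D.Space where
  smul_assoc r a v := by
    have h : D.toEnd (r • a) = r • D.toEnd a := by simp [toEnd, QuiverAlg.smul_def, mul_smul]
    exact DFunLike.congr_fun h v

/-- The identity, as a linear equivalence onto the module of a representation. -/
def of : V ≃ₗ[K] D.Space := LinearEquiv.refl K V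

@[simp] lemma e₁_smul (v : V) : (QuiverAlg.e₁ : QuiverAlg K) • D.of v = D.of (D.e₁ v) :=
  DFunLike.congr_fun (by simp [toEnd, QuiverAlg.e₁] : D.toEnd QuiverAlg.e₁ = D.e₁) v
@[simp] lemma e₂_smul (v : V) : (QuiverAlg.e₂ : QuiverAlg K) • D.of v = D.of (D.e₂ v) :=
  DFunLike.congr_fun (by simp [toEnd, QuiverAlg.e₂] : D.toEnd QuiverAlg.e₂ = D.e₂) v
@[simp] lemma α_smul (v : V) : (QuiverAlg.α : QuiverAlg K) • D.of v = D.of (D.α v) :=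
  DFunLike.congr_fun (by simp [toEnd, QuiverAlg.α] : D.toEnd QuiverAlg.α = D.α) v
@[simp] lemma β_smul (v : V) : (QuiverAlg.β : QuiverAlg K) • D.of v = D.of (D.β v) :=
  DFunLike.congr_fun (by simp [toEnd, QuiverAlg.β] : D.toEnd QuiverAlg.β = D.β) v
@[simp] lemma γ_smul (v : V) : (QuiverAlg.γ : QuiverAlg K) • D.of v = D.of (D.γ v) :=
  DFunLike.congr_fun (by simp [toEnd, QuiverAlg.γ] : D.toEnd QuiverAlg.γ = D.γ) v
@[simp] lemma ρ_smul (v : V) : (QuiverAlg.ρ : QuiverAlg K) • D.of v = D.of (D.α v + D.γ v) := by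
  rw [QuiverAlg.ρ_smul, α_smul, γ_smul, map_add]

end Rep

section Hom

variable {M N : Type*} [AddCommGroup M] [Module (QuiverAlg K) M] [Module K M]
  [IsScalarTower K (QuiverAlg K) M] [AddCommGroup N] [Module (QuiverAlg K) N] [Module K N]
  [IsScalarTower K (QuiverAlg K) N]

/-- A linear map commuting with the actions of the generators is a module homomorphism. -/
def homMk (f : M →ₗ[K] N) (h₁ : ∀ m, f ((e₁ : QuiverAlg K) • m) = (e₁ : QuiverAlg K) • f m)
    (ha : ∀ m, f ((α : QuiverAlg K) • m) = (α : QuiverAlg K) • f m)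
    (hb : ∀ m, f ((β : QuiverAlg K) • m) = (β : QuiverAlg K) • f m)
    (hg : ∀ m, f ((γ : QuiverAlg K) • m) = (γ : QuiverAlg K) • f m) : M →ₗ[QuiverAlg K] N where
  toFun := f
  map_add' := f.map_add
  map_smul' a m := by
    have h₂ : f ((e₂ : QuiverAlg K) • m) = (e₂ : QuiverAlg K) • f m := by
      rw [← add_right_inj ((e₁ : QuiverAlg K) • f m), e₁_add_e₂_smul, ← h₁, ← map_add,
        e₁_add_e₂_smul]
    rw [RingHom.id_apply, smul_eq m a, smul_eq (f m) a]
    simp [h₁, h₂, ha, hb, hg]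

variable {V : Type u} [AddCommGroup V] [Module K V] (D : Rep K V)

/-- A homomorphism from the module of a representation. -/
def spaceLift (f : V →ₗ[K] N) (h₁ : ∀ v, f (D.e₁ v) = (e₁ : QuiverAlg K) • f v)
    (ha : ∀ v, f (D.α v) = (α : QuiverAlg K) • f v)
    (hb : ∀ v, f (D.β v) = (β : QuiverAlg K) • f v)
    (hg : ∀ v, f (D.γ v) = (γ : QuiverAlg K) • f v) : D.Space →ₗ[QuiverAlg K] N :=
  homMk (f ∘ₗ D.of.symm.toLinearMap)
    (D.of.surjective.forall.mpr fun v => by simpa using h₁ v)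
    (D.of.surjective.forall.mpr fun v => by simpa using ha v)
    (D.of.surjective.forall.mpr fun v => by simpa using hb v)
    (D.of.surjective.forall.mpr fun v => by simpa using hg v)

@[simp] lemma spaceLift_of (f : V →ₗ[K] N) (h₁ ha hb hg) (v : V) :
    spaceLift D f h₁ ha hb hg (D.of v) = f v := rfl

/-- A homomorphism to the module of a representation. -/
def spaceColift (f : M →ₗ[K] V) (h₁ : ∀ m, f ((e₁ : QuiverAlg K) • m) = D.e₁ (f m))
    (ha : ∀ m, f ((α : QuiverAlg K) • m) = D.α (f m))
    (hb : ∀ m, f ((β : QuiverAlg K) • m) = D.β (f m))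
    (hg : ∀ m, f ((γ : QuiverAlg K) • m) = D.γ (f m)) : M →ₗ[QuiverAlg K] D.Space :=
  homMk (D.of.toLinearMap ∘ₗ f) (fun m => by simp [h₁]) (fun m => by simp [ha])
    (fun m => by simp [hb]) (fun m => by simp [hg])

variable (K M) in
/-- The action of an element of the algebra as a linear map. -/
abbrev act (a : QuiverAlg K) : M →ₗ[K] M := Algebra.lsmul K K M a

end Hom

section Exact

variable (K) in
/-- The square-zero operator `ρ` on `M` has vanishing homology. -/
def IsExact (M : Type*) [AddCommGroup M] [Module (QuiverAlg K) M] : Prop :=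
  ∀ m : M, (ρ : QuiverAlg K) • m = 0 → ∃ w : M, (ρ : QuiverAlg K) • w = m

lemma Rep.isExact {V : Type u} [AddCommGroup V] [Module K V] (D : Rep K V)
    (h : ∀ v, D.α v + D.γ v = 0 → ∃ w, D.α w + D.γ w = v) : IsExact K D.Space := by
  intro m hm
  obtain ⟨v, rfl⟩ := D.of.surjective m
  obtain ⟨w, rfl⟩ := h v (D.of.map_eq_zero_iff.mp (by rw [← Rep.ρ_smul, hm]))
  exact ⟨D.of w, D.ρ_smul w⟩

variable {M N P : Type*} [AddCommGroup M] [Module (QuiverAlg K) M]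
  [AddCommGroup N] [Module (QuiverAlg K) N] [AddCommGroup P] [Module (QuiverAlg K) P]

@[simp] lemma ρ_ρ_smul (m : M) : (ρ : QuiverAlg K) • (ρ : QuiverAlg K) • m = 0 := by
  simp [ρ_smul]
lemma e₁_ρ_smul (m : M) :
    (e₁ : QuiverAlg K) • (ρ : QuiverAlg K) • m = (γ : QuiverAlg K) • m := by simp [ρ_smul]

lemma IsExact.exists_γ_smul (h : IsExact K M) {m : M} (hm : (α : QuiverAlg K) • m = 0) :
    ∃ w : M, (γ : QuiverAlg K) • w = (e₁ : QuiverAlg K) • m := by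
  obtain ⟨w, hw⟩ := h ((e₁ : QuiverAlg K) • m) (by simp [ρ_smul, hm])
  exact ⟨w, by rw [← e₁_ρ_smul, hw, e₁_e₁_smul]⟩

lemma IsExact.β_smul_eq_zero (h : IsExact K M) {m : M} (hm : (α : QuiverAlg K) • m = 0) :
    (β : QuiverAlg K) • m = 0 := by
  obtain ⟨w, hw⟩ := h.exists_γ_smul hm
  rw [← β_e₁_smul, ← hw, β_γ_smul]

lemma IsExact.of_surjective {g : P →ₗ[QuiverAlg K] M} (hg : Function.Surjective g)
    (hP : IsExact K P) (hK : IsExact K (LinearMap.ker g)) : IsExact K M := by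
  intro m hm
  obtain ⟨p, rfl⟩ := hg m
  obtain ⟨⟨k, hk⟩, hkp⟩ := hK ⟨(ρ : QuiverAlg K) • p, by simpa using hm⟩ (by ext; simp)
  obtain ⟨q, hq⟩ := hP (p - k) (by
    rw [smul_sub, sub_eq_zero]; exact (congrArg Subtype.val hkp).symm)
  refine ⟨g q, ?_⟩
  rw [← map_smul, hq, map_sub, LinearMap.mem_ker.mp hk, sub_zero]

lemma IsExact.ker {g : P →ₗ[QuiverAlg K] M} (hg : Function.Surjective g)
    (hP : IsExact K P) (hM : IsExact K M) : IsExact K (LinearMap.ker g) := by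
  rintro ⟨k, hk⟩ hk0
  obtain ⟨p, hp⟩ := hP k (congrArg Subtype.val hk0)
  obtain ⟨m, hm⟩ := hM (g p) (by rw [← map_smul, hp, LinearMap.mem_ker.mp hk])
  obtain ⟨q, rfl⟩ := hg m
  refine ⟨⟨p - (ρ : QuiverAlg K) • q, by simp [hm]⟩, ?_⟩
  ext
  simp [smul_sub, hp]

lemma isExact_finsupp (ι : Type*) : IsExact K (ι →₀ QuiverAlg K) := by
  intro f hf
  refine ⟨f.mapRange (fun a => ⟨a.ca, a.cg, 0, a.cd, 0, 0⟩) (by simp [zero_def]), ?_⟩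
  ext1 i
  have h := DFunLike.congr_fun hf i
  simp only [Finsupp.smul_apply, smul_eq_mul, ρ, mul_def, Finsupp.coe_zero, Pi.zero_apply,
    zero_def, QuiverAlg.mk.injEq] at h
  simp only [Finsupp.smul_apply, smul_eq_mul, ρ, mul_def, Finsupp.mapRange_apply]
  ext <;> simp_all

lemma isExact_of_projective [Module.Projective (QuiverAlg K) P] : IsExact K P := by
  intro p hp
  obtain ⟨s, hs⟩ := Module.Projective.out (R := QuiverAlg K) (P := P)
  obtain ⟨w, hw⟩ := isExact_finsupp P (s p) (by rw [← map_smul, hp, map_zero])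
  exact ⟨Finsupp.linearCombination (QuiverAlg K) id w, by rw [← map_smul, hw, hs p]⟩

lemma α_smul_eq_zero_of_projective [Module.Projective (QuiverAlg K) P] {p : P}
    (hp : (β : QuiverAlg K) • p = 0) : (α : QuiverAlg K) • p = 0 := by
  obtain ⟨s, hs⟩ := Module.Projective.out (R := QuiverAlg K) (P := P)
  rw [← hs ((α : QuiverAlg K) • p), map_smul s]
  have h : (β : QuiverAlg K) • s p = 0 := by rw [← map_smul, hp, map_zero]
  suffices h0 : (α : QuiverAlg K) • s p = 0 by rw [h0, map_zero]
  ext1 i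
  have h := DFunLike.congr_fun h i
  simp only [Finsupp.smul_apply, smul_eq_mul, β, mul_def, Finsupp.coe_zero, Pi.zero_apply,
    zero_def, QuiverAlg.mk.injEq] at h
  simp only [Finsupp.smul_apply, smul_eq_mul, α, mul_def, Finsupp.coe_zero, Pi.zero_apply]
  ext <;> simp_all [zero_def]

lemma IsExact.of_hasProjDimLE {n : ℕ} {M : ModuleCat.{u} (QuiverAlg K)}
    (h : HasProjDimLE (QuiverAlg K) n M) : IsExact K M := by
  induction n generalizing M with
  | zero => have : Module.Projective (QuiverAlg K) M := h; exact isExact_of_projective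
  | succ n ih =>
    obtain ⟨P, g, _, hg, hK⟩ := h
    exact IsExact.of_surjective hg isExact_of_projective (ih hK)

end Exact

section Homotopy

/-- Every endomorphism of a vector space has a generalized inverse. -/
lemma exists_generalized_inverse {V : Type*} [AddCommGroup V] [Module K V] (d : V →ₗ[K] V) :
    ∃ t : V →ₗ[K] V, ∀ v, d (t (d v)) = d v := by
  obtain ⟨r, hr⟩ := d.rangeRestrict.exists_rightInverse_of_surjective d.range_rangeRestrict
  obtain ⟨p, hp⟩ := (LinearMap.range d).subtype.exists_leftInverse_of_injective
    (LinearMap.range d).ker_subtype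
  refine ⟨r ∘ₗ p, fun v => ?_⟩
  have h1 : p (d v) = ⟨d v, v, rfl⟩ := DFunLike.congr_fun hp (⟨d v, v, rfl⟩ : LinearMap.range d)
  have h2 := congrArg Subtype.val (DFunLike.congr_fun hr (⟨d v, v, rfl⟩ : LinearMap.range d))
  simpa [h1] using h2

/-- An exact differential on a vector space has a contracting homotopy. -/
lemma exists_contracting_homotopy {V : Type*} [AddCommGroup V] [Module K V] (d : V →ₗ[K] V)
    (h : ∀ v, d v = 0 → ∃ w, d w = v) (hd : ∀ v, d (d v) = 0) :
    ∃ s : V →ₗ[K] V, ∀ v, d (s v) + s (d v) = v := by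
  obtain ⟨t, hdt⟩ := exists_generalized_inverse d
  refine ⟨t - t ∘ₗ t ∘ₗ d, fun v => ?_⟩
  obtain ⟨w, hw⟩ := h (v - t (d v)) (by simp [hdt])
  have := hdt w
  rw [hw] at this
  simp only [LinearMap.sub_apply, LinearMap.comp_apply, hd, map_zero, sub_zero, map_sub] at this ⊢
  rw [this, sub_add_cancel]

variable {M : Type*} [AddCommGroup M] [Module (QuiverAlg K) M] [Module K M]
  [IsScalarTower K (QuiverAlg K) M]

/-- On an exact module there is a contracting homotopy for `ρ` which exchanges the two vertices. -/
lemma IsExact.exists_homotopy (h : IsExact K M) : ∃ s : M →ₗ[K] M,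
    (∀ m, (ρ : QuiverAlg K) • s m + s ((ρ : QuiverAlg K) • m) = m) ∧
    (∀ m, s ((e₁ : QuiverAlg K) • m) = (e₂ : QuiverAlg K) • s m) ∧
    (∀ m, s ((e₂ : QuiverAlg K) • m) = (e₁ : QuiverAlg K) • s m) := by
  obtain ⟨s, hs⟩ := exists_contracting_homotopy (act K M ρ) h (fun v => ρ_ρ_smul (K := K) v)
  simp only [Algebra.lsmul_coe] at hs
  refine ⟨act K M e₁ ∘ₗ s ∘ₗ act K M e₂ + act K M e₂ ∘ₗ s ∘ₗ act K M e₁, fun m => ?_, fun m => ?_,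
    fun m => ?_⟩
  · have h1 := congrArg (fun x => (e₁ : QuiverAlg K) • x) (hs ((e₁ : QuiverAlg K) • m))
    have h2 := congrArg (fun x => (e₂ : QuiverAlg K) • x) (hs ((e₂ : QuiverAlg K) • m))
    simp only [ρ_smul, smul_add, e₁_α_smul, e₁_γ_smul, e₁_e₁_smul, α_e₁_smul, γ_e₁_smul,
      e₂_α_smul, e₂_γ_smul, e₂_e₂_smul, α_e₂_smul, γ_e₂_smul, zero_add, add_zero] at h1 h2
    conv_rhs => rw [← e₁_add_e₂_smul (K := K) m, ← h1, ← h2]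
    simp [ρ_smul]
    abel
  · simp
  · simp

end Homotopy

section ProjDim

variable {M : Type u} [AddCommGroup M] [Module (QuiverAlg K) M] [Module K M]
  [IsScalarTower K (QuiverAlg K) M]

/-- An exact module on which `α` and `β` act trivially is a direct sum of copies of the
indecomposable projective module at the vertex `2`. -/
lemma IsExact.projective (h : IsExact K M) (ha : ∀ m : M, (α : QuiverAlg K) • m = 0)
    (hb : ∀ m : M, (β : QuiverAlg K) • m = 0) : Module.Projective (QuiverAlg K) M := by
  refine Module.Projective.of_lifting_property'' fun f hf => ?_
  obtain ⟨s, hs, hs₁, hs₂⟩ := h.exists_homotopy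
  obtain ⟨σ, hσ⟩ := (f.restrictScalars K).exists_rightInverse_of_surjective
    (LinearMap.range_eq_top.mpr hf)
  have hσ (m : M) : f (σ m) = m := DFunLike.congr_fun hσ m
  have hsg (m : M) : s ((γ : QuiverAlg K) • m) = (e₂ : QuiverAlg K) • m := by
    have := congrArg (fun x => (e₂ : QuiverAlg K) • x) (hs ((e₂ : QuiverAlg K) • m))
    simpa [ρ_smul, ha, ← hs₁] using this
  have hgs (m : M) : (γ : QuiverAlg K) • s m = (e₁ : QuiverAlg K) • m := by
    have := congrArg (fun x => (e₁ : QuiverAlg K) • x) (hs ((e₁ : QuiverAlg K) • m))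
    simpa [ρ_smul, ha, hs₁] using this
  refine ⟨homMk (act K _ e₂ ∘ₗ σ ∘ₗ act K M e₂ + act K _ γ ∘ₗ σ ∘ₗ s ∘ₗ act K M e₁)
    ?_ ?_ ?_ ?_, ?_⟩
  · intro m; simp
  · intro m; simp [ha]
  · intro m; simp [hb]
  · intro m; simp [hsg]
  · ext m
    change f ((e₂ : QuiverAlg K) • σ ((e₂ : QuiverAlg K) • m) +
      (γ : QuiverAlg K) • σ (s ((e₁ : QuiverAlg K) • m))) = m
    rw [map_add, map_smul f, map_smul f, hσ, hσ, hgs, e₁_e₁_smul, e₂_e₂_smul, add_comm,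
      e₁_add_e₂_smul]

/-- The direct sum of copies of the indecomposable projective module at the vertex `2`, indexed by
a basis of `V`. -/
@[simps] def projRep (V : Type u) [AddCommGroup V] [Module K V] : Rep K (V × V) where
  e₁ := LinearMap.inl K V V ∘ₗ LinearMap.fst K V V
  e₂ := LinearMap.inr K V V ∘ₗ LinearMap.snd K V V
  α := 0
  β := 0
  γ := LinearMap.inl K V V ∘ₗ LinearMap.snd K V V
  add_eq_one := by ext <;> simp
  e₁_e₁ := by ext <;> simp
  e₂_α := by simp
  α_e₁ := by simp
  e₂_β := by simp
  β_e₁ := by simp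
  e₁_γ := by ext <;> simp
  γ_e₂ := by ext <;> simp
  α_γ := by simp
  β_γ := by simp
  γ_α := by simp

instance (V : Type u) [AddCommGroup V] [Module K V] :
    Module.Projective (QuiverAlg K) (projRep (K := K) V).Space := by
  refine IsExact.projective (K := K) (Rep.isExact _ ?_) ?_ ?_
  · rintro ⟨x, y⟩ h
    have hy : y = 0 := by simpa using h
    exact ⟨(0, x), by simp [hy]⟩
  · exact (Rep.of _).surjective.forall.mpr fun v => by simp
  · exact (Rep.of _).surjective.forall.mpr fun v => by simp

variable (K M) in
/-- The canonical map onto `e₂ M + γ M`. -/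
def projRepHom : (projRep (K := K) M).Space →ₗ[QuiverAlg K] M :=
  spaceLift _ ((act K M γ).coprod (act K M e₂)) (fun v => by simp)
    (fun v => by simp) (fun v => by simp) (fun v => by simp)

lemma projRepHom_of (x y : M) :
    projRepHom K M (Rep.of _ (x, y)) = (γ : QuiverAlg K) • x + (e₂ : QuiverAlg K) • y := by
  simp [projRepHom]

/-- A free module together with the projective cover of the vertex `2` part gives a projective
presentation of an exact module. -/
lemma IsExact.hasProjDimLE_one (h : IsExact K M) :
    HasProjDimLE (QuiverAlg K) 1 (ModuleCat.of (QuiverAlg K) M) := by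
  have hα : ∀ q : (projRep (K := K) M).Space, (α : QuiverAlg K) • q = 0 :=
    (Rep.of _).surjective.forall.mpr fun v => by simp
  have hβ : ∀ q : (projRep (K := K) M).Space, (β : QuiverAlg K) • q = 0 :=
    (Rep.of _).surjective.forall.mpr fun v => by simp
  let b := Module.Basis.ofVectorSpace K (LinearMap.range (act K M α))
  choose m hm using fun i => (b i).2
  have hli : LinearIndependent K fun i => (α : QuiverAlg K) • m i := by
    have := b.linearIndependent.map' (Submodule.subtype _) (Submodule.ker_subtype _)
    exact (funext hm : (fun i => (α : QuiverAlg K) • m i) = _) ▸ this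
  let g := (Finsupp.linearCombination (QuiverAlg K) m).coprod (projRepHom K M)
  have hc (f : Module.Basis.ofVectorSpaceIndex K (LinearMap.range (act K M α)) →₀ QuiverAlg K) :
      (α : QuiverAlg K) • Finsupp.linearCombination (QuiverAlg K) m f =
        Finsupp.linearCombination K (fun i => (α : QuiverAlg K) • m i)
          (f.mapRange c₁ rfl) := by
    rw [Finsupp.linearCombination_apply, Finsupp.linearCombination_apply,
      Finsupp.sum_mapRange_index (by simp), Finsupp.smul_sum]
    refine Finsupp.sum_congr fun i _ => ?_
    rw [← mul_smul, ← smul_assoc]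
    congr 1
    ext <;> simp [α, mul_def, smul_def]
  have hg : Function.Surjective g := by
    intro x
    have hx : (α : QuiverAlg K) • x ∈ LinearMap.range (act K M α) := ⟨x, rfl⟩
    let l := b.repr ⟨_, hx⟩
    let y := Finsupp.linearCombination K m l
    have hy : (α : QuiverAlg K) • y = (α : QuiverAlg K) • x := by
      have h1 := congrArg (LinearMap.range (act K M α)).subtype (b.linearCombination_repr ⟨_, hx⟩)
      rw [Finsupp.apply_linearCombination] at h1
      refine ((act K M α).map_finsupp_linearCombination l).trans (Eq.trans ?_ h1)
      exact congrArg (fun v => Finsupp.linearCombination K v l) (funext hm)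
    obtain ⟨w, hw⟩ := h.exists_γ_smul (m := x - y) (by rw [smul_sub, hy, sub_self])
    let l' := l.mapRange (algebraMap K (QuiverAlg K)) (map_zero _)
    have hl : Finsupp.linearCombination (QuiverAlg K) m l' = y := by
      rw [Finsupp.linearCombination_apply, Finsupp.sum_mapRange_index (by simp)]
      exact Finsupp.sum_congr fun i _ => algebraMap_smul _ _ _
    refine ⟨(l', Rep.of _ (w, x - y)), ?_⟩
    simp only [g, LinearMap.coprod_apply, hl, projRepHom_of]
    rw [hw, e₁_add_e₂_smul, add_sub_cancel]
  refine ⟨ModuleCat.of _ ((_ →₀ QuiverAlg K) × (projRep (K := K) M).Space), g,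
    inferInstanceAs (Module.Projective _ (_ × _)), hg, ?_⟩
  have hzero : ∀ p ∈ LinearMap.ker g, p.1.mapRange c₁ rfl = 0 := by
    rintro ⟨f, q⟩ hp
    have h0 : (α : QuiverAlg K) • (Finsupp.linearCombination (QuiverAlg K) m f +
      projRepHom K M q) = 0 := by
      have : Finsupp.linearCombination (QuiverAlg K) m f + projRepHom K M q = 0 := hp
      rw [this, smul_zero]
    have h1 : (α : QuiverAlg K) • projRepHom K M q = 0 := by
      rw [← map_smul, hα, map_zero]
    rw [smul_add, hc, h1, add_zero] at h0
    exact hli.finsuppLinearCombination_injective (h0.trans (map_zero _).symm)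
  have hzero' : ∀ p ∈ LinearMap.ker g, ∀ i, (p.1 i).c₁ = 0 := fun p hp i =>
    DFunLike.congr_fun (hzero p hp) i
  refine IsExact.projective (K := K) (M := LinearMap.ker g)
    (IsExact.ker hg isExact_of_projective h) ?_ ?_
  · rintro ⟨p, hp⟩
    refine Subtype.ext (Prod.ext (Finsupp.ext fun i => ?_) ?_)
    · change α * p.1 i = 0
      ext <;> simp [α, mul_def, zero_def]
      exact hzero' p hp i
    · exact hα p.2
  · rintro ⟨p, hp⟩
    refine Subtype.ext (Prod.ext (Finsupp.ext fun i => ?_) ?_)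
    · change β * p.1 i = 0
      ext <;> simp [β, mul_def, zero_def]
      exact hzero' p hp i
    · exact hβ p.2

end ProjDim

section FinitisticDimension

/-- The vector space structure on a module over `QuiverAlg K`. -/
abbrev vectorSpace (M : Type u) [AddCommGroup M] [Module (QuiverAlg K) M] : Module K M :=
  Module.compHom M (algebraMap K (QuiverAlg K))

lemma isScalarTower_vectorSpace (M : Type u) [AddCommGroup M] [Module (QuiverAlg K) M] :
    let _ : Module K M := vectorSpace M
    IsScalarTower K (QuiverAlg K) M :=
  let _ : Module K M := vectorSpace M
  IsScalarTower.of_algebraMap_smul fun _ _ => rfl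

lemma HasFinProjDim.isExact {M : ModuleCat.{u} (QuiverAlg K)}
    (h : HasFinProjDim (QuiverAlg K) M) : IsExact K M :=
  h.elim fun _ => IsExact.of_hasProjDimLE

lemma hasProjDimLE_one_of_hasFinProjDim {M : ModuleCat.{u} (QuiverAlg K)}
    (h : HasFinProjDim (QuiverAlg K) M) : HasProjDimLE (QuiverAlg K) 1 M := by
  let _ : Module K M := vectorSpace M
  have : IsScalarTower K (QuiverAlg K) M := isScalarTower_vectorSpace M
  exact (HasFinProjDim.isExact h).hasProjDimLE_one

/-- The representation in which `α` is an isomorphism, `β` is given by `f` and `γ = 0`. -/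
@[simps] def kroneckerRep {U : Type u} [AddCommGroup U] [Module K U] (f : U →ₗ[K] U) :
    Rep K (U × U) where
  e₁ := LinearMap.inl K U U ∘ₗ LinearMap.fst K U U
  e₂ := LinearMap.inr K U U ∘ₗ LinearMap.snd K U U
  α := LinearMap.inr K U U ∘ₗ LinearMap.fst K U U
  β := LinearMap.inr K U U ∘ₗ f ∘ₗ LinearMap.fst K U U
  γ := 0
  add_eq_one := by ext <;> simp
  e₁_e₁ := by ext <;> simp
  e₂_α := by ext <;> simp
  α_e₁ := by ext <;> simp
  e₂_β := by ext <;> simp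
  β_e₁ := by ext <;> simp
  e₁_γ := by simp
  γ_e₂ := by simp
  α_γ := by simp
  β_γ := by simp
  γ_α := by simp

lemma isExact_kroneckerRep {U : Type u} [AddCommGroup U] [Module K U] (f : U →ₗ[K] U) :
    IsExact K (kroneckerRep f).Space := by
  refine Rep.isExact _ ?_
  rintro ⟨x, y⟩ h
  have hx : x = 0 := by simpa using h
  exact ⟨(y, 0), by simp [hx]⟩

lemma not_projective_kroneckerRep_zero :
    ¬ Module.Projective (QuiverAlg K) (kroneckerRep (0 : K →ₗ[K] K)).Space := by
  intro _
  have h := α_smul_eq_zero_of_projective (K := K)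
    (p := (kroneckerRep (0 : K →ₗ[K] K)).of (1, 0)) (by simp)
  simp at h

variable (K) in
lemma finDimBig_eq_one : finDimBig (QuiverAlg K) = 1 := by
  refine le_antisymm
    (iSup₂_le fun M hM => sInf_le ⟨1, rfl, hasProjDimLE_one_of_hasFinProjDim hM⟩) ?_
  have h1 := (isExact_kroneckerRep (0 : K →ₗ[K] K)).hasProjDimLE_one
  refine le_trans (le_sInf ?_) (le_iSup₂
    (f := fun (M : ModuleCat.{u} (QuiverAlg K)) (_ : HasFinProjDim _ M) => projDim _ M)
    (ModuleCat.of (QuiverAlg K) _) ⟨1, h1⟩)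
  rintro _ ⟨n, rfl, hn⟩
  rcases n with _ | n
  · exact absurd hn not_projective_kroneckerRep_zero
  · exact_mod_cast Nat.le_add_left 1 n

end FinitisticDimension

section Contravariant

/-- The left shift on `K ^ n`. -/
def shift (n : ℕ) : (Fin n → K) →ₗ[K] (Fin n → K) where
  toFun x i := if h : i.1 + 1 < n then x ⟨i.1 + 1, h⟩ else 0
  map_add' x y := by ext i; dsimp only [Pi.add_apply]; split_ifs <;> simp
  map_smul' r x := by ext i; dsimp only [Pi.smul_apply]; split_ifs <;> simp

lemma eq_bot_of_shift_mem {n : ℕ} (S : Submodule K (Fin (n + 1) → K))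
    (hS : ∀ x ∈ S, shift (n + 1) x ∈ S) (h0 : ∀ x ∈ S, x 0 = 0) : S = ⊥ := by
  have h (k : ℕ) (hk : k < n + 1) : ∀ x ∈ S, x ⟨k, hk⟩ = 0 := by
    induction k with
    | zero => exact h0
    | succ k ih =>
      intro x hx
      have := ih (Nat.lt_of_succ_lt hk) _ (hS x hx)
      simpa [shift, Nat.succ_lt_succ_iff.mp hk] using this
  exact (Submodule.eq_bot_iff S).mpr fun x hx => funext fun i => h i.1 i.2 x hx

variable (K) in
/-- The simple representation at the vertex `1`. -/
@[simps] def simpleRep : Rep K K where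
  e₁ := 1
  e₂ := 0
  α := 0
  β := 0
  γ := 0
  add_eq_one := by simp
  e₁_e₁ := by simp
  e₂_α := by simp
  α_e₁ := by simp
  e₂_β := by simp
  β_e₁ := by simp
  e₁_γ := by simp
  γ_e₂ := by simp
  α_γ := by simp
  β_γ := by simp
  γ_α := by simp

/-- The homomorphism from a Kronecker representation to the simple module at the vertex `1` given by
a linear form. -/
def kroneckerHom {U : Type u} [AddCommGroup U] [Module K U] (f : U →ₗ[K] U) (φ : U →ₗ[K] K) :
    (kroneckerRep f).Space →ₗ[QuiverAlg K] (simpleRep K).Space :=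
  spaceLift _ ((simpleRep K).of.toLinearMap ∘ₗ φ ∘ₗ LinearMap.fst K U U)
    (fun v => by simp) (fun v => by simp) (fun v => by simp) (fun v => by simp)

variable (K) in
lemma not_contravariantlyFinite : ¬ ContravariantlyFinite (QuiverAlg K) := by
  intro h
  have : Module.Finite (QuiverAlg K) (simpleRep K).Space :=
    Module.Finite.of_restrictScalars_finite K _ _
  obtain ⟨A, f, hAf, hA, hlift⟩ := h (ModuleCat.of _ (simpleRep K).Space) this
  replace hA := HasFinProjDim.isExact hA
  let _ : Module K A := vectorSpace A
  have : IsScalarTower K (QuiverAlg K) A := isScalarTower_vectorSpace A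
  have : FiniteDimensional K A := Module.Finite.trans (QuiverAlg K) A
  let n := Module.finrank K A
  let D := kroneckerRep (shift (K := K) (n + 1))
  have hD : Module.Finite (QuiverAlg K) D.Space := Module.Finite.of_restrictScalars_finite K _ _
  obtain ⟨g, hg⟩ := hlift (ModuleCat.of _ D.Space) hD
    ⟨1, (isExact_kroneckerRep _).hasProjDimLE_one⟩
    (kroneckerHom _ (LinearMap.proj 0))
  change D.Space →ₗ[QuiverAlg K] A at g
  let j : (Fin (n + 1) → K) →ₗ[K] A :=
    g.restrictScalars K ∘ₗ D.of.toLinearMap ∘ₗ LinearMap.inr K _ _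
  have hα (x : Fin (n + 1) → K) : j x = (α : QuiverAlg K) • g (D.of (x, 0)) := by
    rw [← map_smul]; simp [j, D]
  have hker : LinearMap.ker j = ⊥ := by
    refine eq_bot_of_shift_mem _ (fun x hx => ?_) fun x hx => ?_
    · rw [LinearMap.mem_ker, hα] at hx
      have := hA.β_smul_eq_zero hx
      rw [← map_smul] at this
      simpa [j, D] using this
    · rw [LinearMap.mem_ker, hα] at hx
      obtain ⟨w, hw⟩ := hA.exists_γ_smul hx
      have h1 := congrArg f hw
      have h2 : f (g (D.of (x, 0))) = (simpleRep K).of (x 0) :=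
        DFunLike.congr_fun hg (D.of (x, 0))
      obtain ⟨v, hv⟩ := (simpleRep K).of.surjective (f w)
      rw [map_smul f, map_smul f, h2, ← hv] at h1
      simpa using h1.symm
  have := LinearMap.finrank_le_finrank_of_injective (LinearMap.ker_eq_bot.mp hker)
  simp [n] at this

end Contravariant

section Covariant

/-- The smallest submodule modulo which the kernel of `α` is contained in the kernel of `β`. -/
def kerClosure (M : Type*) [AddCommGroup M] [Module (QuiverAlg K) M] :
    Submodule (QuiverAlg K) M :=
  sInf {N | ∀ m : M, (α : QuiverAlg K) • m ∈ N → (β : QuiverAlg K) • m ∈ N}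

lemma β_smul_mem_kerClosure {M : Type*} [AddCommGroup M] [Module (QuiverAlg K) M] {m : M}
    (h : (α : QuiverAlg K) • m ∈ kerClosure (K := K) M) :
    (β : QuiverAlg K) • m ∈ kerClosure (K := K) M := by
  simp only [kerClosure, Submodule.mem_sInf] at h ⊢
  exact fun N hN => hN m (h N hN)

lemma kerClosure_le_ker {M B : Type*} [AddCommGroup M] [Module (QuiverAlg K) M]
    [AddCommGroup B] [Module (QuiverAlg K) B] (hB : IsExact K B) (f : M →ₗ[QuiverAlg K] B) :
    kerClosure M ≤ LinearMap.ker f :=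
  sInf_le fun m hm => by
    simp only [LinearMap.mem_ker, map_smul] at hm ⊢
    exact hB.β_smul_eq_zero hm

variable {M : Type u} [AddCommGroup M] [Module (QuiverAlg K) M] [Module K M]
  [IsScalarTower K (QuiverAlg K) M]

/-- The representation obtained by embedding `M` into a module coinduced from the subalgebra
generated by `α` and `γ` and adjoining free values of `β`. -/
@[simps] def approxRep (b c : M →ₗ[K] M) : Rep K (M × M × M × M) where
  e₁ := (act K M e₁).prodMap ((act K M e₂).prodMap (LinearMap.id.prodMap 0))
  e₂ := (act K M e₂).prodMap ((act K M e₁).prodMap ((0 : M →ₗ[K] M).prodMap LinearMap.id))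
  α := LinearMap.inl K _ _ ∘ₗ act K M e₂ ∘ₗ LinearMap.fst K _ _ ∘ₗ LinearMap.snd K M _
  γ := (act K M e₁ ∘ₗ LinearMap.fst K _ _ ∘ₗ LinearMap.snd K M _).prod
    ((0 : _ →ₗ[K] M).prod ((LinearMap.snd K _ _ ∘ₗ LinearMap.snd K _ _ ∘ₗ LinearMap.snd K M _).prod
      (0 : _ →ₗ[K] M)))
  β := ((act K M e₂ ∘ₗ b).prod ((act K M γ ∘ₗ b).prod ((0 : M →ₗ[K] M).prod c))) ∘ₗ
    act K M e₂ ∘ₗ LinearMap.fst K _ _ ∘ₗ LinearMap.snd K M _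
  add_eq_one := LinearMap.ext fun ⟨x, y, z, w⟩ => by
    simp [e₁_add_e₂_smul, add_comm ((e₂ : QuiverAlg K) • y)]
  e₁_e₁ := LinearMap.ext fun ⟨x, y, z, w⟩ => by simp
  e₂_α := LinearMap.ext fun ⟨x, y, z, w⟩ => by simp
  α_e₁ := LinearMap.ext fun ⟨x, y, z, w⟩ => by simp
  e₂_β := LinearMap.ext fun ⟨x, y, z, w⟩ => by simp
  β_e₁ := LinearMap.ext fun ⟨x, y, z, w⟩ => by simp
  e₁_γ := LinearMap.ext fun ⟨x, y, z, w⟩ => by simp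
  γ_e₂ := LinearMap.ext fun ⟨x, y, z, w⟩ => by simp
  α_γ := LinearMap.ext fun ⟨x, y, z, w⟩ => by simp
  β_γ := LinearMap.ext fun ⟨x, y, z, w⟩ => by simp
  γ_α := LinearMap.ext fun ⟨x, y, z, w⟩ => by simp

lemma isExact_approxRep (b c : M →ₗ[K] M) : IsExact K (approxRep b c).Space := by
  refine Rep.isExact _ ?_
  rintro ⟨x, y, z, w⟩ h
  simp only [approxRep_α, approxRep_γ] at h
  simp [e₁_add_e₂_smul, add_comm] at h
  refine ⟨(0, x, 0, z), ?_⟩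
  rw [add_comm]
  simp [h, e₁_add_e₂_smul]

/-- The canonical homomorphism from `M` to its approximation. -/
def toApproxRep (b c : M →ₗ[K] M) (hb : ∀ m, b ((α : QuiverAlg K) • m) = (β : QuiverAlg K) • m)
    (hc : ∀ m, c ((α : QuiverAlg K) • m) = 0) : M →ₗ[QuiverAlg K] (approxRep b c).Space :=
  spaceColift _ (LinearMap.id.prod ((act K M ρ).prod 0))
    (fun m => by simp [ρ_smul, ← Prod.zero_eq_mk]) (fun m => by simp [ρ_smul, ← Prod.zero_eq_mk])
    (fun m => by simp [ρ_smul, hb, hc, ← Prod.zero_eq_mk])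
    (fun m => by simp [ρ_smul, ← Prod.zero_eq_mk])

/-- If the kernel of `α` on `M` is contained in the kernel of `β`, then `M` has a left
approximation. -/
lemma exists_leftApprox [FiniteDimensional K M]
    (h : ∀ m : M, (α : QuiverAlg K) • m = 0 → (β : QuiverAlg K) • m = 0) :
    ∃ (A : ModuleCat.{u} (QuiverAlg K)) (f : M →ₗ[QuiverAlg K] A),
      IsLeftApprox (QuiverAlg K) (ModuleCat.of (QuiverAlg K) M) A f := by
  obtain ⟨t, ht⟩ := exists_generalized_inverse (act K M α)
  simp only [Algebra.lsmul_coe] at ht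
  let b : M →ₗ[K] M := act K M β ∘ₗ t
  let c : M →ₗ[K] M := LinearMap.id - act K M α ∘ₗ t
  have hb (m : M) : b ((α : QuiverAlg K) • m) = (β : QuiverAlg K) • m := by
    have := h (t ((α : QuiverAlg K) • m) - m) (by rw [smul_sub, ht, sub_self])
    rwa [smul_sub, sub_eq_zero] at this
  have hc (m : M) : c ((α : QuiverAlg K) • m) = 0 := by
    simp [c, ht]
  refine ⟨ModuleCat.of _ (approxRep b c).Space, toApproxRep b c hb hc,
    Module.Finite.of_restrictScalars_finite K _ _, ⟨1, (isExact_approxRep b c).hasProjDimLE_one⟩,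
    fun B _ hB f => ?_⟩
  change M →ₗ[QuiverAlg K] B at f
  replace hB := HasFinProjDim.isExact hB
  let _ : Module K B := vectorSpace B
  have : IsScalarTower K (QuiverAlg K) B := isScalarTower_vectorSpace B
  obtain ⟨s, hs, hs₁, hs₂⟩ := hB.exists_homotopy
  let k : M →ₗ[K] B := act K B β ∘ₗ s ∘ₗ f.restrictScalars K - f.restrictScalars K ∘ₗ b
  have hk (m : M) : k m = (β : QuiverAlg K) • s (f m) - f (b m) := rfl
  have hkα (m : M) : k ((α : QuiverAlg K) • m) = 0 := by
    have h1 := congrArg (fun x => (β : QuiverAlg K) • x) (hs ((e₁ : QuiverAlg K) • f m))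
    simp only [ρ_smul, hs₁, smul_add, α_e₂_smul, γ_e₂_smul, α_e₁_smul, γ_e₁_smul, β_γ_smul,
      β_e₁_smul, zero_add, add_zero] at h1
    rw [hk, hb, map_smul f, map_smul f, h1, sub_self]
  have hkc (m : M) : k (c m) = k m := by
    have : c m = m - (α : QuiverAlg K) • t m := rfl
    rw [this, map_sub, hkα, sub_zero]
  let S : M →ₗ[K] B := s ∘ₗ f.restrictScalars K
  have hβ (y : M) : (ρ : QuiverAlg K) • S ((e₂ : QuiverAlg K) • b ((e₂ : QuiverAlg K) • y)) +
      (S ((γ : QuiverAlg K) • b ((e₂ : QuiverAlg K) • y)) +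
        (e₂ : QuiverAlg K) • k (c ((e₂ : QuiverAlg K) • y))) = (β : QuiverAlg K) • S y := by
    have h1 := hs ((e₂ : QuiverAlg K) • f (b ((e₂ : QuiverAlg K) • y)))
    rw [ρ_smul ((e₂ : QuiverAlg K) • _), α_e₂_smul, γ_e₂_smul, zero_add] at h1
    simp only [S, LinearMap.comp_apply, LinearMap.restrictScalars_apply]
    rw [map_smul f, map_smul f γ, ← add_assoc, h1, hkc, hk, smul_sub, e₂_β_smul, map_smul f e₂ y,
      hs₂, β_e₁_smul, add_sub_cancel]
  obtain ⟨F, hF⟩ : ∃ F : (approxRep b c).Space →ₗ[QuiverAlg K] B, ∀ x y z w,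
      F (Rep.of _ (x, y, z, w)) = (ρ : QuiverAlg K) • S x + (S y +
        ((γ : QuiverAlg K) • k z + (e₂ : QuiverAlg K) • k w)) := by
    refine ⟨spaceLift _ ((act K B ρ ∘ₗ S).coprod (S.coprod
      ((act K B γ ∘ₗ k).coprod (act K B e₂ ∘ₗ k)))) ?_ ?_ ?_ ?_, fun _ _ _ _ => rfl⟩
    · rintro ⟨x, y, z, w⟩
      simp [S, hs₁, hs₂, ρ_smul]
    · rintro ⟨x, y, z, w⟩
      simp [S, hs₂, ρ_smul]
    · rintro ⟨x, y, z, w⟩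
      simpa [ρ_smul (S x)] using hβ y
    · rintro ⟨x, y, z, w⟩
      simp [S, hs₁, ρ_smul]
  refine ⟨F, LinearMap.ext fun m => (hF m ((ρ : QuiverAlg K) • m) 0 0).trans ?_⟩
  simp [S, hs]

variable (K) in
lemma covariantlyFinite : CovariantlyFinite (QuiverAlg K) := by
  intro M _
  let N := kerClosure (K := K) M
  let _ : Module K (M ⧸ N) := vectorSpace (M ⧸ N)
  have : IsScalarTower K (QuiverAlg K) (M ⧸ N) := isScalarTower_vectorSpace (M ⧸ N)
  have : FiniteDimensional K (M ⧸ N) := Module.Finite.trans (QuiverAlg K) (M ⧸ N)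
  obtain ⟨A, f, hA, hAp, hf⟩ := exists_leftApprox (K := K) (M := M ⧸ N) (by
    intro m hm
    obtain ⟨m, rfl⟩ := N.mkQ_surjective m
    rw [← map_smul, Submodule.mkQ_apply, Submodule.Quotient.mk_eq_zero] at hm ⊢
    exact β_smul_mem_kerClosure hm)
  refine ⟨A, f ∘ₗ N.mkQ, hA, hAp, fun B hB hBp g => ?_⟩
  obtain ⟨h, hh⟩ := hf B hB hBp (N.liftQ g (kerClosure_le_ker (HasFinProjDim.isExact hBp) g))
  exact ⟨h, by rw [← LinearMap.comp_assoc, hh, Submodule.liftQ_mkQ]⟩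

end Covariant

end QuiverAlg

/-- Igusa–Smalø–Todorov.  For every field `K` there exists a
finite-dimensional `K`-algebra `Λ` with `l.Findim Λ = 1` such that `P^∞(Λ-mod)` is covariantly
finite but not contravariantly finite in `Λ-mod`.  In particular, contravariant finiteness of
`P^∞(Λ-mod)` is strictly stronger than covariant finiteness. -/
theorem exists_covariantlyFinite_not_contravariantlyFinite (K : Type u) [Field K] :
    ∃ Λ : FDAlg K, finDimBig Λ.carrier = 1 ∧ CovariantlyFinite Λ.carrier ∧
      ¬ ContravariantlyFinite Λ.carrier := by
  exact ⟨⟨QuiverAlg K⟩, QuiverAlg.finDimBig_eq_one K, QuiverAlg.covariantlyFinite K,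
    QuiverAlg.not_contravariantlyFinite K⟩
end

section
/- For every field K there exist a finite-dimensional associative unital K-algebra Δ and an idempotent f ∈ Δ with the following properties: P^∞(Δ-mod) is contravariantly finite in Δ-mod, while for the quotient algebra Λ = Δ/I, where I is the two-sided ideal of Δ generated by f, the subcategory P^∞(Λ-mod) is not contravariantly finite in Λ-mod. In other words, failure of contravariant finiteness of P^∞(Λ-mod) can be cured by passing to a suitable finite-dimensional extension algebra Δ of which Λ is the quotient modulo the ideal generated by an idempotent. -/
universe u

section FinitisticDimensionZero

variable {R : Type*} [Ring R]

/-- An element of a projective module that is killed by the whole left annihilator of `J` lies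
in `J • ⊤`, provided this holds in the regular module. -/
theorem mem_smul_top_of_projective {J : Ideal R}
    (hJ : ∀ q : R, (∀ s : R, (∀ j ∈ J, s * j = 0) → s * q = 0) → q ∈ J)
    {Q : Type*} [AddCommGroup Q] [Module R Q] [Module.Projective R Q] (q : Q)
    (hq : ∀ s : R, (∀ j ∈ J, s * j = 0) → s • q = 0) : q ∈ J • (⊤ : Submodule R Q) := by
  obtain ⟨σ, hσ⟩ := Module.projective_def'.1 (inferInstance : Module.Projective R Q)
  have hcoord : ∀ x, σ q x ∈ J := fun x ↦ hJ _ fun s hs ↦ by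
    have := congrArg (fun v ↦ v x) (congrArg σ (hq s hs))
    simpa using this
  have h : Finsupp.linearCombination R id (σ q) = q := LinearMap.congr_fun hσ q
  rw [← h, Finsupp.linearCombination_apply]
  exact Submodule.sum_mem _ fun x _ ↦ Submodule.smul_mem_smul (hcoord x) trivial

/-- If `J` is a nilpotent two-sided ideal with semisimple quotient such that every simple right
module embeds in `R`, then every monomorphism of projective left modules splits. -/
theorem exists_retraction_of_projective {J : Ideal R} [J.IsTwoSided] [IsSemisimpleRing (R ⧸ J)]
    (hnil : IsNilpotent J)
    (hJ : ∀ q : R, (∀ s : R, (∀ j ∈ J, s * j = 0) → s * q = 0) → q ∈ J)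
    {P Q : Type*} [AddCommGroup P] [Module R P] [AddCommGroup Q] [Module R Q]
    [Module.Projective R P] [Module.Projective R Q] (i : Q →ₗ[R] P)
    (hi : Function.Injective i) : ∃ r : P →ₗ[R] Q, r ∘ₗ i = LinearMap.id := by
  have hsoc : ∀ p ∈ J • (⊤ : Submodule R P), ∀ s : R, (∀ j ∈ J, s * j = 0) → s • p = 0 := by
    intro p hp s hs
    refine Submodule.smul_induction_on hp (fun j hj n _ ↦ ?_) fun x y hx hy ↦ ?_
    · rw [← mul_smul, hs j hj, zero_smul]
    · rw [smul_add, hx, hy, add_zero]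
  have hle : J • (⊤ : Submodule R Q) ≤ (J • (⊤ : Submodule R P)).comap i := by
    rw [← Submodule.map_le_iff_le_comap, Submodule.map_smul'']
    exact Submodule.smul_mono le_rfl le_top
  let ibar := Submodule.mapQ _ _ i hle
  have hibar : Function.Injective ibar := by
    rw [injective_iff_map_eq_zero]
    intro x hx
    obtain ⟨q, rfl⟩ := Submodule.mkQ_surjective _ x
    have hx' : i q ∈ J • (⊤ : Submodule R P) := by
      simpa [ibar] using hx
    have : q ∈ J • (⊤ : Submodule R Q) := mem_smul_top_of_projective hJ q fun s hs ↦ hi (by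
      rw [map_smul, hsoc _ hx' s hs, map_zero])
    simpa using this
  have htors : Module.IsTorsionBySet R (P ⧸ J • (⊤ : Submodule R P)) J :=
    (Module.isTorsionBySet_quotient_iff _ _).2 fun m r hr ↦ Submodule.smul_mem_smul hr trivial
  have hss : IsSemisimpleModule R (P ⧸ J • (⊤ : Submodule R P)) := by
    let _ := htors.module
    exact (htors.semilinearMap.isSemisimpleModule_iff_of_bijective Function.bijective_id).2
      inferInstance
  obtain ⟨rbar, hrbar⟩ := IsSemisimpleModule.extension_property ibar hibar LinearMap.id
  obtain ⟨r, hr⟩ := Module.projective_lifting_property (J • (⊤ : Submodule R Q)).mkQ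
    (rbar ∘ₗ (J • (⊤ : Submodule R P)).mkQ) (Submodule.mkQ_surjective _)
  let φ : Module.End R Q := 1 - r ∘ₗ i
  have hφ : LinearMap.range φ ≤ J • (⊤ : Submodule R Q) := by
    rintro _ ⟨q, rfl⟩
    have h1 : (J • (⊤ : Submodule R Q)).mkQ (r (i q)) = (J • (⊤ : Submodule R Q)).mkQ q := by
      have := LinearMap.congr_fun hr (i q)
      have h2 := LinearMap.congr_fun hrbar ((J • (⊤ : Submodule R Q)).mkQ q)
      simp only [LinearMap.comp_apply, LinearMap.id_apply] at this h2
      rw [this, ← h2]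
      simp [ibar]
    rw [← Submodule.ker_mkQ (J • (⊤ : Submodule R Q)), LinearMap.mem_ker]
    simp only [φ, LinearMap.sub_apply, map_sub, LinearMap.comp_apply, h1, Module.End.one_apply,
      sub_self]
  have hpow : ∀ n : ℕ, LinearMap.range (φ ^ n) ≤ J ^ n • (⊤ : Submodule R Q) := by
    intro n
    induction n with
    | zero => rw [Submodule.pow_zero, Ideal.one_eq_top, Submodule.top_smul]; exact le_top
    | succ n ih =>
      rw [pow_succ', Module.End.mul_eq_comp, LinearMap.range_comp]
      refine (Submodule.map_mono ih).trans ?_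
      rw [Submodule.map_smul'', Submodule.pow_succ, Submodule.mul_smul]
      refine Submodule.smul_mono le_rfl ?_
      rw [Submodule.map_top]
      exact hφ
  obtain ⟨n, hn⟩ := hnil
  have hφn : IsNilpotent φ := ⟨n, by
    rw [← LinearMap.range_eq_bot, ← le_bot_iff]
    refine (hpow n).trans ?_
    rw [hn]
    simp⟩
  obtain ⟨w, hw⟩ := hφn.isUnit_one_sub
  refine ⟨(↑w⁻¹ : Module.End R Q) ∘ₗ r, ?_⟩
  have : r ∘ₗ i = (w : Module.End R Q) := by rw [hw]; simp [φ]
  rw [LinearMap.comp_assoc, this]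
  exact w.inv_mul

theorem projective_of_ker_retraction {P M : Type*} [AddCommGroup P] [Module R P]
    [AddCommGroup M] [Module R M] [Module.Projective R P] (g : P →ₗ[R] M)
    (hg : Function.Surjective g) (r : P →ₗ[R] LinearMap.ker g)
    (hr : r ∘ₗ (LinearMap.ker g).subtype = LinearMap.id) : Module.Projective R M := by
  let c : P →ₗ[R] P := LinearMap.id - (LinearMap.ker g).subtype ∘ₗ r
  have hc : LinearMap.ker g ≤ LinearMap.ker c := fun x hx ↦ by
    have := LinearMap.congr_fun hr ⟨x, hx⟩
    simp only [LinearMap.comp_apply, Submodule.subtype_apply, LinearMap.id_apply] at this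
    simp [c, this]
  let σ : M →ₗ[R] P :=
    (LinearMap.ker g).liftQ c hc ∘ₗ (g.quotKerEquivOfSurjective hg).symm.toLinearMap
  refine Module.Projective.of_split σ g (LinearMap.ext fun m ↦ ?_)
  obtain ⟨p, rfl⟩ := hg m
  have : (g.quotKerEquivOfSurjective hg).symm (g p) = (LinearMap.ker g).mkQ p := by
    rw [LinearEquiv.symm_apply_eq]
    rfl
  simp [σ, this, c]

end FinitisticDimensionZero

theorem projective_of_hasProjDimLE {R : Type u} [Ring R] {J : Ideal R} [J.IsTwoSided]
    [IsSemisimpleRing (R ⧸ J)] (hnil : IsNilpotent J)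
    (hJ : ∀ q : R, (∀ s : R, (∀ j ∈ J, s * j = 0) → s * q = 0) → q ∈ J) (n : ℕ) :
    ∀ M : ModuleCat.{u} R, HasProjDimLE R n M → Module.Projective R M := by
  induction n with
  | zero => exact fun M h ↦ h
  | succ n ih =>
    rintro M ⟨P, g, hP, hg, hker⟩
    have hker' : Module.Projective R (LinearMap.ker g) := ih _ hker
    obtain ⟨r, hr⟩ := exists_retraction_of_projective hnil hJ (LinearMap.ker g).subtype
      (LinearMap.ker g).injective_subtype
    exact projective_of_ker_retraction g hg r hr

theorem contravariantlyFinite_of_projective {R : Type u} [Ring R]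
    (h : ∀ M : ModuleCat.{u} R, HasFinProjDim R M → Module.Projective R M) :
    ContravariantlyFinite R := by
  intro M hM
  obtain ⟨n, f, hf⟩ := Module.Finite.exists_fin' R M
  refine ⟨ModuleCat.of R (Fin n → R), f, inferInstanceAs (Module.Finite R (Fin n → R)),
    ⟨0, inferInstanceAs (Module.Projective R (Fin n → R))⟩, fun B _ hB g ↦ ?_⟩
  have := h B hB
  exact Module.projective_lifting_property f g hf

/-- The algebra of the quiver with arrows `a, b : 1 → 2` and `c : 2 → 1`, with relations
`ac = bc = cb = 0`. The coordinates refer to the basis `e₁, e₂, a, b, c, ca`. -/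
@[ext]
structure QuiverAlg_s10 (K : Type u) where
  e₁ : K
  e₂ : K
  a : K
  b : K
  c : K
  ca : K

namespace QuiverAlg_s10

variable {K : Type u} [Field K]

instance inst_s10 : Zero (QuiverAlg_s10 K) := ⟨⟨0, 0, 0, 0, 0, 0⟩⟩
instance inst_s10_2 : One (QuiverAlg_s10 K) := ⟨⟨1, 1, 0, 0, 0, 0⟩⟩
instance inst_s10_3 : Add (QuiverAlg_s10 K) :=
  ⟨fun x y ↦ ⟨x.e₁ + y.e₁, x.e₂ + y.e₂, x.a + y.a, x.b + y.b, x.c + y.c, x.ca + y.ca⟩⟩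
instance inst_s10_4 : Neg (QuiverAlg_s10 K) := ⟨fun x ↦ ⟨-x.e₁, -x.e₂, -x.a, -x.b, -x.c, -x.ca⟩⟩
instance inst_s10_5 : Mul (QuiverAlg_s10 K) :=
  ⟨fun x y ↦ ⟨x.e₁ * y.e₁, x.e₂ * y.e₂, x.e₂ * y.a + x.a * y.e₁, x.e₂ * y.b + x.b * y.e₁,
    x.e₁ * y.c + x.c * y.e₂, x.e₁ * y.ca + x.ca * y.e₁ + x.c * y.a⟩⟩
instance inst_s10_6 : SMul K (QuiverAlg_s10 K) :=
  ⟨fun k x ↦ ⟨k * x.e₁, k * x.e₂, k * x.a, k * x.b, k * x.c, k * x.ca⟩⟩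

@[simp] theorem zero_e₁ : (0 : QuiverAlg_s10 K).e₁ = 0 := rfl
@[simp] theorem zero_e₂ : (0 : QuiverAlg_s10 K).e₂ = 0 := rfl
@[simp] theorem zero_a : (0 : QuiverAlg_s10 K).a = 0 := rfl
@[simp] theorem zero_b : (0 : QuiverAlg_s10 K).b = 0 := rfl
@[simp] theorem zero_c : (0 : QuiverAlg_s10 K).c = 0 := rfl
@[simp] theorem zero_ca : (0 : QuiverAlg_s10 K).ca = 0 := rfl
@[simp] theorem one_e₁ : (1 : QuiverAlg_s10 K).e₁ = 1 := rfl
@[simp] theorem one_e₂ : (1 : QuiverAlg_s10 K).e₂ = 1 := rfl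
@[simp] theorem one_a : (1 : QuiverAlg_s10 K).a = 0 := rfl
@[simp] theorem one_b : (1 : QuiverAlg_s10 K).b = 0 := rfl
@[simp] theorem one_c : (1 : QuiverAlg_s10 K).c = 0 := rfl
@[simp] theorem one_ca : (1 : QuiverAlg_s10 K).ca = 0 := rfl

section Operations

variable (x y : QuiverAlg_s10 K) (k : K)

@[simp] theorem add_e₁ : (x + y).e₁ = x.e₁ + y.e₁ := rfl
@[simp] theorem add_e₂ : (x + y).e₂ = x.e₂ + y.e₂ := rfl
@[simp] theorem add_a : (x + y).a = x.a + y.a := rfl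
@[simp] theorem add_b : (x + y).b = x.b + y.b := rfl
@[simp] theorem add_c : (x + y).c = x.c + y.c := rfl
@[simp] theorem add_ca : (x + y).ca = x.ca + y.ca := rfl
@[simp] theorem neg_e₁ : (-x).e₁ = -x.e₁ := rfl
@[simp] theorem neg_e₂ : (-x).e₂ = -x.e₂ := rfl
@[simp] theorem neg_a : (-x).a = -x.a := rfl
@[simp] theorem neg_b : (-x).b = -x.b := rfl
@[simp] theorem neg_c : (-x).c = -x.c := rfl
@[simp] theorem neg_ca : (-x).ca = -x.ca := rfl
@[simp] theorem mul_e₁ : (x * y).e₁ = x.e₁ * y.e₁ := rfl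
@[simp] theorem mul_e₂ : (x * y).e₂ = x.e₂ * y.e₂ := rfl
@[simp] theorem mul_a : (x * y).a = x.e₂ * y.a + x.a * y.e₁ := rfl
@[simp] theorem mul_b : (x * y).b = x.e₂ * y.b + x.b * y.e₁ := rfl
@[simp] theorem mul_c : (x * y).c = x.e₁ * y.c + x.c * y.e₂ := rfl
@[simp] theorem mul_ca : (x * y).ca = x.e₁ * y.ca + x.ca * y.e₁ + x.c * y.a := rfl
@[simp] theorem smul_e₁ : (k • x).e₁ = k * x.e₁ := rfl
@[simp] theorem smul_e₂ : (k • x).e₂ = k * x.e₂ := rfl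
@[simp] theorem smul_a : (k • x).a = k * x.a := rfl
@[simp] theorem smul_b : (k • x).b = k * x.b := rfl
@[simp] theorem smul_c : (k • x).c = k * x.c := rfl
@[simp] theorem smul_ca : (k • x).ca = k * x.ca := rfl

end Operations

instance inst_s10_7 : Ring (QuiverAlg_s10 K) where
  add_assoc x y z := by ext <;> simp [add_assoc]
  zero_add x := by ext <;> simp
  add_zero x := by ext <;> simp
  add_comm x y := by ext <;> simp [add_comm]
  neg_add_cancel x := by ext <;> simp
  mul_assoc x y z := by ext <;> simp <;> ring
  one_mul x := by ext <;> simp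
  mul_one x := by ext <;> simp
  left_distrib x y z := by ext <;> simp <;> ring
  right_distrib x y z := by ext <;> simp <;> ring
  zero_mul x := by ext <;> simp
  mul_zero x := by ext <;> simp
  nsmul := nsmulRec
  zsmul := zsmulRec

instance inst_s10_8 : Module K (QuiverAlg_s10 K) where
  one_smul x := by ext <;> simp
  mul_smul k l x := by ext <;> simp [mul_assoc]
  smul_zero k := by ext <;> simp
  smul_add k x y := by ext <;> simp [mul_add]
  add_smul k l x := by ext <;> simp [add_mul]
  zero_smul x := by ext <;> simp

instance inst_s10_9 : Algebra K (QuiverAlg_s10 K) :=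
  Algebra.ofModule (fun k x y ↦ by ext <;> simp <;> ring) fun k x y ↦ by ext <;> simp <;> ring

/-- The one-dimensional representation at the vertex `1`. -/
def e₁Hom (K : Type u) [Field K] : QuiverAlg_s10 K →+* K where
  toFun := e₁
  map_zero' := rfl
  map_one' := rfl
  map_add' _ _ := rfl
  map_mul' _ _ := rfl

end QuiverAlg_s10

/-- The extension of `QuiverAlg K` by a vertex `3` with a loop `t` and an arrow
`s : 2 → 3`, with relations `sa = sb = ts = t² = 0`. -/
@[ext]
structure ExtQuiverAlg (K : Type u) where
  base : QuiverAlg_s10 K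
  e₃ : K
  s : K
  t : K

namespace ExtQuiverAlg

variable {K : Type u} [Field K]

instance : Zero (ExtQuiverAlg K) := ⟨⟨0, 0, 0, 0⟩⟩
instance : One (ExtQuiverAlg K) := ⟨⟨1, 1, 0, 0⟩⟩
instance : Add (ExtQuiverAlg K) :=
  ⟨fun x y ↦ ⟨x.base + y.base, x.e₃ + y.e₃, x.s + y.s, x.t + y.t⟩⟩
instance : Neg (ExtQuiverAlg K) := ⟨fun x ↦ ⟨-x.base, -x.e₃, -x.s, -x.t⟩⟩
instance : Mul (ExtQuiverAlg K) :=
  ⟨fun x y ↦ ⟨x.base * y.base, x.e₃ * y.e₃, x.e₃ * y.s + x.s * y.base.e₂,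
    x.e₃ * y.t + x.t * y.e₃⟩⟩
instance : SMul K (ExtQuiverAlg K) := ⟨fun k x ↦ ⟨k • x.base, k * x.e₃, k * x.s, k * x.t⟩⟩

@[simp] theorem zero_base : (0 : ExtQuiverAlg K).base = 0 := rfl
@[simp] theorem zero_e₃ : (0 : ExtQuiverAlg K).e₃ = 0 := rfl
@[simp] theorem zero_s : (0 : ExtQuiverAlg K).s = 0 := rfl
@[simp] theorem zero_t : (0 : ExtQuiverAlg K).t = 0 := rfl
@[simp] theorem one_base : (1 : ExtQuiverAlg K).base = 1 := rfl
@[simp] theorem one_e₃ : (1 : ExtQuiverAlg K).e₃ = 1 := rfl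
@[simp] theorem one_s : (1 : ExtQuiverAlg K).s = 0 := rfl
@[simp] theorem one_t : (1 : ExtQuiverAlg K).t = 0 := rfl

section Operations

variable (x y : ExtQuiverAlg K) (k : K)

@[simp] theorem add_base : (x + y).base = x.base + y.base := rfl
@[simp] theorem add_e₃ : (x + y).e₃ = x.e₃ + y.e₃ := rfl
@[simp] theorem add_s : (x + y).s = x.s + y.s := rfl
@[simp] theorem add_t : (x + y).t = x.t + y.t := rfl
@[simp] theorem neg_base : (-x).base = -x.base := rfl
@[simp] theorem neg_e₃ : (-x).e₃ = -x.e₃ := rfl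
@[simp] theorem neg_s : (-x).s = -x.s := rfl
@[simp] theorem neg_t : (-x).t = -x.t := rfl
@[simp] theorem mul_base : (x * y).base = x.base * y.base := rfl
@[simp] theorem mul_e₃ : (x * y).e₃ = x.e₃ * y.e₃ := rfl
@[simp] theorem mul_s : (x * y).s = x.e₃ * y.s + x.s * y.base.e₂ := rfl
@[simp] theorem mul_t : (x * y).t = x.e₃ * y.t + x.t * y.e₃ := rfl
@[simp] theorem smul_base : (k • x).base = k • x.base := rfl
@[simp] theorem smul_e₃ : (k • x).e₃ = k * x.e₃ := rfl
@[simp] theorem smul_s : (k • x).s = k * x.s := rfl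
@[simp] theorem smul_t : (k • x).t = k * x.t := rfl

end Operations

instance : Ring (ExtQuiverAlg K) where
  add_assoc x y z := by ext1 <;> simp [add_assoc]
  zero_add x := by ext1 <;> simp
  add_zero x := by ext1 <;> simp
  add_comm x y := by ext1 <;> simp [add_comm]
  neg_add_cancel x := by ext1 <;> simp
  mul_assoc x y z := by
    ext1
    · simp [mul_assoc]
    all_goals simp; ring
  one_mul x := by ext1 <;> simp
  mul_one x := by ext1 <;> simp
  left_distrib x y z := by
    ext1
    · simp [mul_add]
    all_goals simp; ring
  right_distrib x y z := by
    ext1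
    · simp [add_mul]
    all_goals simp; ring
  zero_mul x := by ext1 <;> simp
  mul_zero x := by ext1 <;> simp
  nsmul := nsmulRec
  zsmul := zsmulRec

instance : Module K (ExtQuiverAlg K) where
  one_smul x := by ext1 <;> simp
  mul_smul k l x := by ext1 <;> simp [mul_assoc, mul_smul]
  smul_zero k := by ext1 <;> simp
  smul_add k x y := by ext1 <;> simp [mul_add]
  add_smul k l x := by ext1 <;> simp [add_mul, add_smul]
  zero_smul x := by ext1 <;> simp

instance : Algebra K (ExtQuiverAlg K) :=
  Algebra.ofModule
    (fun k x y ↦ by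
      ext1
      · simp
      all_goals simp; ring)
    fun k x y ↦ by
      ext1
      · simp
      all_goals simp; ring

instance : FiniteDimensional K (ExtQuiverAlg K) := by
  let f : ExtQuiverAlg K →ₗ[K] (Fin 9 → K) :=
    { toFun := fun x ↦ ![x.base.e₁, x.base.e₂, x.base.a, x.base.b, x.base.c, x.base.ca,
        x.e₃, x.s, x.t]
      map_add' := fun x y ↦ by simp
      map_smul' := fun k x ↦ by simp }
  refine FiniteDimensional.of_injective f fun x y h ↦ ?_
  simp only [f, LinearMap.coe_mk, AddHom.coe_mk, Matrix.vecCons_inj] at h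
  ext <;> simp [h]

/-- The projection onto the quotient by the two-sided ideal generated by the new vertex. -/
def toBase (K : Type u) [Field K] : ExtQuiverAlg K →ₐ[K] QuiverAlg_s10 K :=
  AlgHom.ofLinearMap ⟨⟨base, fun _ _ ↦ rfl⟩, fun _ _ ↦ rfl⟩ rfl fun _ _ ↦ rfl

theorem toBase_surjective : Function.Surjective (toBase K) := fun x ↦ ⟨⟨x, 0, 0, 0⟩, rfl⟩

theorem mem_span_e₃_iff (x : ExtQuiverAlg K) :
    x ∈ TwoSidedIdeal.span {(⟨0, 1, 0, 0⟩ : ExtQuiverAlg K)} ↔ x.base = 0 := by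
  constructor
  · intro hx
    have : TwoSidedIdeal.span {(⟨0, 1, 0, 0⟩ : ExtQuiverAlg K)} ≤
        TwoSidedIdeal.ker (toBase K) := by
      rw [TwoSidedIdeal.span_le, Set.singleton_subset_iff]
      exact (TwoSidedIdeal.mem_ker _).2 rfl
    exact (TwoSidedIdeal.mem_ker _).1 (this hx)
  · intro hx
    have : x = ⟨0, 1, 0, 0⟩ * x + x * ⟨0, 1, 0, 0⟩ - ⟨0, 1, 0, 0⟩ * x * ⟨0, 1, 0, 0⟩ := by
      rw [sub_eq_add_neg]
      ext1 <;> simp [hx]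
    have he := TwoSidedIdeal.subset_span (Set.mem_singleton (⟨0, 1, 0, 0⟩ : ExtQuiverAlg K))
    rw [this]
    exact sub_mem (add_mem (TwoSidedIdeal.mul_mem_right _ _ _ he)
      (TwoSidedIdeal.mul_mem_left _ _ _ he))
      (TwoSidedIdeal.mul_mem_left _ _ _ he)

/-- The projection onto the semisimple quotient. -/
def diagHom (K : Type u) [Field K] : ExtQuiverAlg K →+* (K × K) × K where
  toFun x := ((x.base.e₁, x.base.e₂), x.e₃)
  map_zero' := rfl
  map_one' := rfl
  map_add' _ _ := rfl
  map_mul' _ _ := rfl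

theorem mem_ker_diagHom (x : ExtQuiverAlg K) :
    x ∈ RingHom.ker (diagHom K) ↔ x.base.e₁ = 0 ∧ x.base.e₂ = 0 ∧ x.e₃ = 0 := by
  simp [RingHom.mem_ker, diagHom, and_assoc]

theorem diagHom_surjective : Function.Surjective (diagHom K) :=
  fun x ↦ ⟨⟨⟨x.1.1, x.1.2, 0, 0, 0, 0⟩, x.2, 0, 0⟩, rfl⟩

theorem isNilpotent_ker_diagHom : IsNilpotent (RingHom.ker (diagHom K)) := by
  refine ⟨3, le_bot_iff.1 ?_⟩
  rw [Submodule.pow_succ, Submodule.pow_succ, Submodule.pow_one, mul_assoc, Ideal.mul_le]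
  intro x hx w hw
  refine Submodule.mul_induction_on hw (fun y hy z hz ↦ ?_) fun y z hy hz ↦ ?_
  · rw [mem_ker_diagHom] at hx hy hz
    rw [Submodule.mem_bot]
    ext <;> simp [hx, hy, hz]
  · rw [mul_add]
    exact add_mem hy hz

theorem mem_ker_diagHom_of_annihilator (q : ExtQuiverAlg K)
    (hq : ∀ s : ExtQuiverAlg K, (∀ j ∈ RingHom.ker (diagHom K), s * j = 0) → s * q = 0) :
    q ∈ RingHom.ker (diagHom K) := by
  rw [mem_ker_diagHom]
  refine ⟨?_, ?_, ?_⟩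
  · have := hq ⟨⟨0, 0, 0, 1, 0, 0⟩, 0, 0, 0⟩ fun j hj ↦ by
      rw [mem_ker_diagHom] at hj
      ext <;> simp [hj]
    simpa using congrArg (fun x ↦ x.base.b) this
  · have := hq ⟨0, 0, 1, 0⟩ fun j hj ↦ by
      rw [mem_ker_diagHom] at hj
      ext <;> simp [hj]
    simpa using congrArg s this
  · have := hq ⟨0, 0, 0, 1⟩ fun j hj ↦ by
      rw [mem_ker_diagHom] at hj
      ext <;> simp [hj]
    simpa using congrArg t this

theorem contravariantlyFinite : ContravariantlyFinite (ExtQuiverAlg K) := by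
  have : IsSemisimpleRing (ExtQuiverAlg K ⧸ RingHom.ker (diagHom K)) :=
    (RingHom.quotientKerEquivOfSurjective diagHom_surjective).symm.isSemisimpleRing
  exact contravariantlyFinite_of_projective fun M ⟨n, hn⟩ ↦
    projective_of_hasProjDimLE isNilpotent_ker_diagHom mem_ker_diagHom_of_annihilator n M hn

end ExtQuiverAlg

section Exactness

variable {R : Type u} [Ring R]

theorem exact_smul_of_projective {δ : R} (hδ : ∀ x : R, δ * x = 0 → ∃ y, x = δ * y)
    {P : Type*} [AddCommGroup P] [Module R P] [Module.Projective R P] (p : P) (hp : δ • p = 0) :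
    ∃ q, p = δ • q := by
  obtain ⟨σ, hσ⟩ := Module.projective_def'.1 (inferInstance : Module.Projective R P)
  have hcoord : ∀ x, ∃ y, σ p x = δ * y := fun x ↦ hδ _ (by
    simpa using congrArg (fun v ↦ v x) (congrArg σ hp))
  choose y hy using hcoord
  have h : Finsupp.linearCombination R id (σ p) = p := LinearMap.congr_fun hσ p
  refine ⟨∑ x ∈ (σ p).support, y x • x, ?_⟩
  conv_lhs => rw [← h, Finsupp.linearCombination_apply, Finsupp.sum]
  rw [Finset.smul_sum]
  exact Finset.sum_congr rfl fun x _ ↦ by rw [hy, mul_smul, id]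

/-- If multiplication by `δ` is an exact differential on the regular module, it is exact on all
modules of finite projective dimension. -/
theorem exact_smul_of_hasProjDimLE {δ : R} (hδ : ∀ x : R, δ * x = 0 → ∃ y, x = δ * y)
    (hδδ : δ * δ = 0) (n : ℕ) :
    ∀ M : ModuleCat.{u} R, HasProjDimLE R n M → ∀ m : M, δ • m = 0 → ∃ m', m = δ • m' := by
  induction n with
  | zero =>
    intro M hM
    have : Module.Projective R M := hM
    exact exact_smul_of_projective hδ
  | succ n ih =>
    rintro M ⟨P, g, hP, hg, hker⟩ m hm
    obtain ⟨p, rfl⟩ := hg m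
    have hmem : δ • p ∈ LinearMap.ker g := by rw [LinearMap.mem_ker, map_smul, hm]
    obtain ⟨⟨q, hq⟩, hpq⟩ := ih _ hker ⟨δ • p, hmem⟩
      (Subtype.ext (by rw [SetLike.val_smul, ← mul_smul, hδδ, zero_smul]; rfl))
    have hpq' : δ • p = δ • q := congrArg Subtype.val hpq
    obtain ⟨p', hp'⟩ := exact_smul_of_projective hδ (p - q) (by rw [smul_sub, hpq', sub_self])
    refine ⟨g p', ?_⟩
    rw [← map_smul, ← hp', map_sub, LinearMap.mem_ker.1 hq, sub_zero]

end Exactness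

/-- The representation of the quiver in which `b` is the identity of `V`, `a` is the endomorphism
`T`, and `c` is zero. -/
def KroneckerRep {K V : Type*} [Field K] [AddCommGroup V] [Module K V] (_ : V →ₗ[K] V) :=
  V × V

namespace KroneckerRep

variable {K : Type u} [Field K] {V : Type*} [AddCommGroup V] [Module K V] (T : V →ₗ[K] V)

instance : AddCommGroup (KroneckerRep T) := inferInstanceAs (AddCommGroup (V × V))

instance : Module (QuiverAlg_s10 K) (KroneckerRep T) where
  smul x m := (x.e₁ • m.1, x.a • T m.1 + x.b • m.1 + x.e₂ • m.2)
  one_smul m := Prod.ext (one_smul K m.1) (by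
    change (0 : K) • T m.1 + (0 : K) • m.1 + (1 : K) • m.2 = m.2
    module)
  mul_smul x y m := Prod.ext (mul_smul x.e₁ y.e₁ m.1) (by
    change (x.e₂ * y.a + x.a * y.e₁) • T m.1 + (x.e₂ * y.b + x.b * y.e₁) • m.1 +
      (x.e₂ * y.e₂) • m.2 = x.a • T (y.e₁ • m.1) + x.b • y.e₁ • m.1 +
      x.e₂ • (y.a • T m.1 + y.b • m.1 + y.e₂ • m.2)
    rw [map_smul]
    module)
  smul_zero x := Prod.ext (smul_zero x.e₁) (by
    change x.a • T 0 + x.b • (0 : V) + x.e₂ • (0 : V) = 0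
    simp)
  smul_add x m m' := Prod.ext (smul_add x.e₁ m.1 m'.1) (by
    change x.a • T (m.1 + m'.1) + x.b • (m.1 + m'.1) + x.e₂ • (m.2 + m'.2) =
      x.a • T m.1 + x.b • m.1 + x.e₂ • m.2 + (x.a • T m'.1 + x.b • m'.1 + x.e₂ • m'.2)
    rw [map_add]
    module)
  add_smul x y m := Prod.ext (add_smul x.e₁ y.e₁ m.1) (by
    change (x.a + y.a) • T m.1 + (x.b + y.b) • m.1 + (x.e₂ + y.e₂) • m.2 =
      x.a • T m.1 + x.b • m.1 + x.e₂ • m.2 + (y.a • T m.1 + y.b • m.1 + y.e₂ • m.2)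
    module)
  zero_smul m := Prod.ext (zero_smul K m.1) (by
    change (0 : K) • T m.1 + (0 : K) • m.1 + (0 : K) • m.2 = 0
    module)

theorem smul_def (x : QuiverAlg_s10 K) (m : KroneckerRep T) :
    x • m = ((x.e₁ • m.1, x.a • T m.1 + x.b • m.1 + x.e₂ • m.2) : V × V) := rfl

end KroneckerRep

section Quotient

variable {K : Type u} [Field K] {R : Type u} [Ring R] [Algebra K R] (ρ : R ≃ₐ[K] QuiverAlg_s10 K)
  {n : ℕ} (T : (Fin n → K) →ₗ[K] (Fin n → K))

/-- The inflation of a Kronecker representation along an isomorphism. -/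
def kroneckerModule : ModuleCat.{u} R :=
  letI := Module.compHom (KroneckerRep T) (ρ : R →+* QuiverAlg_s10 K)
  ModuleCat.of R (KroneckerRep T)

theorem kroneckerModule_smul (x : R) (m : kroneckerModule ρ T) :
    x • m = (((ρ x).e₁ • m.1, (ρ x).a • T m.1 + (ρ x).b • m.1 + (ρ x).e₂ • m.2) :
      (Fin n → K) × (Fin n → K)) := rfl

/-- The presentation of a Kronecker representation by a free module. -/
def kroneckerCover : (Fin n → R) →ₗ[R] kroneckerModule ρ T where
  toFun x := ((fun i ↦ (ρ (x i)).e₁, T (fun i ↦ (ρ (x i)).a) + fun i ↦ (ρ (x i)).b) :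
    (Fin n → K) × (Fin n → K))
  map_add' x y := by
    refine Prod.ext (by ext i; simp; rfl) ?_
    change T (fun i ↦ (ρ ((x + y) i)).a) + (fun i ↦ (ρ ((x + y) i)).b) =
      (T (fun i ↦ (ρ (x i)).a) + fun i ↦ (ρ (x i)).b) +
        (T (fun i ↦ (ρ (y i)).a) + fun i ↦ (ρ (y i)).b)
    have h1 : (fun i ↦ (ρ ((x + y) i)).a) = (fun i ↦ (ρ (x i)).a) + fun i ↦ (ρ (y i)).a := by
      ext i; simp
    have h2 : (fun i ↦ (ρ ((x + y) i)).b) = (fun i ↦ (ρ (x i)).b) + fun i ↦ (ρ (y i)).b := by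
      ext i; simp
    rw [h1, h2, map_add]
    abel
  map_smul' r x := by
    refine Prod.ext (by ext i; simp; rfl) ?_
    change T (fun i ↦ (ρ ((r • x) i)).a) + (fun i ↦ (ρ ((r • x) i)).b) =
      (ρ r).a • T (fun i ↦ (ρ (x i)).e₁) + (ρ r).b • (fun i ↦ (ρ (x i)).e₁) +
        (ρ r).e₂ • (T (fun i ↦ (ρ (x i)).a) + fun i ↦ (ρ (x i)).b)
    have h1 : (fun i ↦ (ρ ((r • x) i)).a) =
        (ρ r).e₂ • (fun i ↦ (ρ (x i)).a) + (ρ r).a • fun i ↦ (ρ (x i)).e₁ := by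
      ext i; simp
    have h2 : (fun i ↦ (ρ ((r • x) i)).b) =
        (ρ r).e₂ • (fun i ↦ (ρ (x i)).b) + (ρ r).b • fun i ↦ (ρ (x i)).e₁ := by
      ext i; simp
    rw [h1, h2, map_add, map_smul, map_smul]
    module

theorem kroneckerCover_surjective : Function.Surjective (kroneckerCover ρ T) := by
  intro m
  refine ⟨fun i ↦ ρ.symm ⟨m.1 i, 0, 0, m.2 i, 0, 0⟩, Prod.ext ?_ ?_⟩
  · funext i
    change (ρ (ρ.symm _)).e₁ = m.1 i
    simp only [AlgEquiv.apply_symm_apply]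
  · change T (fun i ↦ (ρ (ρ.symm _)).a) + (fun i ↦ (ρ (ρ.symm _)).b) = m.2
    simp only [AlgEquiv.apply_symm_apply]
    change T 0 + m.2 = m.2
    simp

theorem mem_ker_kroneckerCover (x : Fin n → R) : x ∈ LinearMap.ker (kroneckerCover ρ T) ↔
    (∀ i, (ρ (x i)).e₁ = 0) ∧ ∀ i, (ρ (x i)).b = -T (fun i ↦ (ρ (x i)).a) i := by
  rw [LinearMap.mem_ker]
  refine Prod.ext_iff.trans (and_congr funext_iff ?_)
  change T (fun i ↦ (ρ (x i)).a) + (fun i ↦ (ρ (x i)).b) = 0 ↔ _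
  rw [add_comm, add_eq_zero_iff_eq_neg, funext_iff]
  rfl

/-- A retraction of a free module onto the kernel of the presentation. -/
def kerKroneckerCoverOfFree :
    ((Fin n → R) × (Fin n → R)) →ₗ[R] LinearMap.ker (kroneckerCover ρ T) where
  toFun y := ⟨fun i ↦ ρ.symm ⟨0, (ρ (y.1 i)).e₂, (ρ (y.2 i)).e₂,
    -T (fun i ↦ (ρ (y.2 i)).e₂) i, (ρ (y.1 i)).c, (ρ (y.2 i)).c⟩, by
      rw [mem_ker_kroneckerCover]
      simp⟩
  map_add' y z := by
    have h : (fun i ↦ (ρ ((y + z).2 i)).e₂) =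
        (fun i ↦ (ρ (y.2 i)).e₂) + fun i ↦ (ρ (z.2 i)).e₂ := by ext i; simp
    refine Subtype.ext (funext fun i ↦ ρ.injective ?_)
    change ρ (ρ.symm _) = ρ (ρ.symm _ + ρ.symm _)
    rw [map_add, AlgEquiv.apply_symm_apply, AlgEquiv.apply_symm_apply, AlgEquiv.apply_symm_apply, h]
    ext <;> simp [-neg_add_rev, neg_add]
  map_smul' r y := by
    have h : (fun i ↦ (ρ ((r • y).2 i)).e₂) = (ρ r).e₂ • fun i ↦ (ρ (y.2 i)).e₂ := by
      ext i; simp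
    refine Subtype.ext (funext fun i ↦ ρ.injective ?_)
    change ρ (ρ.symm _) = ρ (r * ρ.symm _)
    rw [map_mul, AlgEquiv.apply_symm_apply, AlgEquiv.apply_symm_apply, h]
    ext <;> simp

/-- The inclusion of the kernel of the presentation in a free module. -/
def kerKroneckerCoverToFree :
    LinearMap.ker (kroneckerCover ρ T) →ₗ[R] (Fin n → R) × (Fin n → R) where
  toFun x := (fun i ↦ ρ.symm ⟨0, (ρ (x.1 i)).e₂, 0, 0, (ρ (x.1 i)).c, 0⟩,
    fun i ↦ ρ.symm ⟨0, (ρ (x.1 i)).a, 0, 0, (ρ (x.1 i)).ca, 0⟩)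
  map_add' x y := by
    refine Prod.ext ?_ ?_ <;> funext i <;> apply ρ.injective <;> ext <;> simp
  map_smul' r x := by
    have hx := ((mem_ker_kroneckerCover ρ T x.1).1 x.2).1
    refine Prod.ext ?_ ?_ <;> funext i <;> apply ρ.injective <;> ext <;> simp [hx]

theorem hasProjDimLE_kroneckerModule : HasProjDimLE R 1 (kroneckerModule ρ T) := by
  refine ⟨ModuleCat.of R (Fin n → R), kroneckerCover ρ T,
    inferInstanceAs (Module.Projective R (Fin n → R)), kroneckerCover_surjective ρ T, ?_⟩
  refine Module.Projective.of_split (P := LinearMap.ker (kroneckerCover ρ T))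
    (kerKroneckerCoverToFree ρ T) (kerKroneckerCoverOfFree ρ T) (LinearMap.ext fun x ↦ ?_)
  obtain ⟨h₁, h₂⟩ := (mem_ker_kroneckerCover ρ T x.1).1 x.2
  ext i
  apply ρ.injective
  ext <;> simp [kerKroneckerCoverToFree, kerKroneckerCoverOfFree, h₁, h₂]

end Quotient

/-- The shift `(v₀, …, vₙ₋₁) ↦ (v₁, …, vₙ₋₁, 0)`. -/
def finShift (K : Type*) [Field K] (n : ℕ) : (Fin n → K) →ₗ[K] (Fin n → K) where
  toFun v i := if h : i.1 + 1 < n then v ⟨i.1 + 1, h⟩ else 0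
  map_add' v w := by
    ext i
    by_cases h : i.1 + 1 < n <;> simp [h]
  map_smul' k v := by
    ext i
    by_cases h : i.1 + 1 < n <;> simp [h]

theorem finShift_iterate {K : Type*} [Field K] {n k : ℕ} (v : Fin n → K) (i : Fin n)
    (h : i.1 + k < n) : (finShift K n)^[k] v i = v ⟨i.1 + k, h⟩ := by
  induction k generalizing v with
  | zero => rfl
  | succ k ih =>
    rw [Function.iterate_succ_apply, ih _ (by omega)]
    exact dif_pos (by simpa [add_assoc] using h)

theorem not_contravariantlyFinite {K : Type u} [Field K] {R : Type u} [Ring R] [Algebra K R]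
    [FiniteDimensional K R] (ρ : R ≃ₐ[K] QuiverAlg_s10 K) : ¬ ContravariantlyFinite R := by
  intro hR
  let _ : Module R K := Module.compHom K ((QuiverAlg_s10.e₁Hom K).comp (ρ : R →+* QuiverAlg_s10 K))
  have hsmul : ∀ (r : R) (k : K), r • k = (ρ r).e₁ * k := fun _ _ ↦ rfl
  have hS : Module.Finite R K := .of_surjective (LinearMap.toSpanSingleton R K 1) fun k ↦
    ⟨ρ.symm ⟨k, 0, 0, 0, 0, 0⟩, by simp [hsmul]⟩
  obtain ⟨A, f, hA, ⟨d, hd⟩, hf⟩ := hR (ModuleCat.of R K) hS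
  let _ : Module K A := Module.compHom A (algebraMap K R)
  have : IsScalarTower K R A := ⟨fun k r x ↦ by
    rw [Algebra.smul_def, mul_smul]; rfl⟩
  have : FiniteDimensional K A := Module.Finite.trans R A
  set n := Module.finrank K A + 1 with hn
  let T := finShift K n
  let g : kroneckerModule ρ T →ₗ[R] ModuleCat.of R K :=
    { toFun := fun m ↦ m.1 0
      map_add' := fun _ _ ↦ rfl
      map_smul' := fun _ _ ↦ rfl }
  obtain ⟨h, hh⟩ := hf (kroneckerModule ρ T)
    (.of_surjective (kroneckerCover ρ T) (kroneckerCover_surjective ρ T))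
    ⟨1, hasProjDimLE_kroneckerModule ρ T⟩ g
  let incl : (Fin n → K) → kroneckerModule ρ T := fun v ↦ ((v, 0) : (Fin n → K) × (Fin n → K))
  let u : (Fin n → K) →ₗ[K] A :=
    { toFun := fun v ↦ h (incl v)
      map_add' := fun v w ↦ by
        rw [← map_add]
        exact congrArg h (Prod.ext rfl (add_zero 0).symm)
      map_smul' := fun k v ↦ by
        change h _ = algebraMap K R k • h _
        rw [← map_smul, kroneckerModule_smul]
        refine congrArg h ?_
        rw [AlgEquiv.commutes, Algebra.algebraMap_eq_smul_one]
        exact Prod.ext (by simp [incl]) (by simp [incl]) }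
  have hfu : ∀ v, f (u v) = v 0 := fun v ↦ LinearMap.congr_fun hh (incl v)
  let a : R := ρ.symm ⟨0, 0, 1, 0, 0, 0⟩
  let δ : R := ρ.symm ⟨0, 0, 0, 1, 1, 0⟩
  have ha : ρ a = ⟨0, 0, 1, 0, 0, 0⟩ := ρ.apply_symm_apply _
  have hδ : ρ δ = ⟨0, 0, 0, 1, 1, 0⟩ := ρ.apply_symm_apply _
  have haδ : a * δ = 0 := ρ.injective (by rw [map_mul, ha, hδ]; ext <;> simp)
  have hδδ : δ * δ = 0 := ρ.injective (by rw [map_mul, hδ]; ext <;> simp)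
  have hexact : ∀ x : R, δ * x = 0 → ∃ y, x = δ * y := by
    intro x hx
    have hx' : ρ δ * ρ x = 0 := by rw [← map_mul, hx, map_zero]
    rw [hδ, QuiverAlg_s10.ext_iff] at hx'
    simp at hx'
    refine ⟨ρ.symm ⟨(ρ x).b, (ρ x).c, (ρ x).ca, 0, 0, 0⟩, ρ.injective ?_⟩
    rw [map_mul, hδ, ρ.apply_symm_apply]
    ext <;> simp [hx']
  have hrel : ∀ v, a • u v = δ • u (T v) := fun v ↦ by
    change a • h _ = δ • h _
    rw [← map_smul, ← map_smul, kroneckerModule_smul, kroneckerModule_smul, ha, hδ]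
    simp [incl]
  obtain ⟨v, hv, hv0⟩ := (Submodule.ne_bot_iff _).1
    (LinearMap.ker_ne_bot_of_finrank_lt (f := u) (by simp [hn]))
  have hstep : ∀ k, a • u (T^[k] v) = 0 ∧ (T^[k] v) 0 = 0 := by
    intro k
    induction k with
    | zero =>
      have : u v = 0 := hv
      refine ⟨by simp [this], ?_⟩
      rw [Function.iterate_zero_apply, ← hfu v, this, map_zero]
    | succ k ih =>
      rw [Function.iterate_succ_apply']
      obtain ⟨w, hw⟩ := exact_smul_of_hasProjDimLE hexact hδδ d A hd (u (T (T^[k] v)))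
        (by rw [← hrel, ih.1])
      refine ⟨by rw [hw, ← mul_smul, haδ, zero_smul], ?_⟩
      rw [← hfu (T (T^[k] v)), hw, map_smul]
      change (ρ δ).e₁ * _ = 0
      rw [hδ, zero_mul]
  refine hv0 (funext fun i ↦ ?_)
  have h1 := finShift_iterate v (0 : Fin n) (k := i.1) (by simp)
  rw [(hstep i).2] at h1
  simpa using h1.symm

/-- For every field `K` there exist a finite-dimensional `K`-algebra `Δ`
and an idempotent `e ∈ Δ` such that `P^∞(Δ-mod)` is contravariantly finite in `Δ-mod`, while
for the quotient algebra `Λ = Δ/I`, where `I` is the two-sided ideal of `Δ` generated by `e`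
(formalized as: any finite-dimensional `K`-algebra `Λ` equipped with a surjective `K`-algebra
homomorphism `π : Δ → Λ` whose kernel is exactly the two-sided ideal generated by `e`), the
subcategory `P^∞(Λ-mod)` is not contravariantly finite in `Λ-mod`. -/
theorem exists_cure_by_idempotent_extension (K : Type u) [Field K] :
    ∃ (Δ : FDAlg K) (e : Δ.carrier), IsIdempotentElem e ∧
      ContravariantlyFinite Δ.carrier ∧
      ∀ (Λ : FDAlg K) (π : Δ.carrier →ₐ[K] Λ.carrier),
        Function.Surjective π →
        (∀ x : Δ.carrier, π x = 0 ↔ x ∈ TwoSidedIdeal.span {e}) →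
        ¬ ContravariantlyFinite Λ.carrier := by

  refine ⟨⟨ExtQuiverAlg K⟩, ⟨0, 1, 0, 0⟩, ?_, ExtQuiverAlg.contravariantlyFinite,
    fun Λ π hπ hker ↦ ?_⟩
  · change (⟨0, 1, 0, 0⟩ * ⟨0, 1, 0, 0⟩ : ExtQuiverAlg K) = ⟨0, 1, 0, 0⟩
    ext1 <;> simp
  · have hI : RingHom.ker π = RingHom.ker (ExtQuiverAlg.toBase K) := by
      ext x
      rw [RingHom.mem_ker, hker, RingHom.mem_ker]
      exact ExtQuiverAlg.mem_span_e₃_iff x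
    exact not_contravariantlyFinite (K := K)
      ((Ideal.quotientKerAlgEquivOfSurjective hπ).symm.trans
        ((Ideal.quotientEquivAlgOfEq K hI).trans
          (Ideal.quotientKerAlgEquivOfSurjective ExtQuiverAlg.toBase_surjective)))
end
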